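/- arXiv:1212.0163 — 2 statements merged into one kernel-verified Lean document; each statement's English description precedes it below -/
import Mathlib

section
/- Abhyankar–Moh–Suzuki theorem: Let K be a field of characteristic zero and f, g ∈ K[z] with K[f, g] = K[z]. Then deg f divides deg g or deg g divides deg f. -/
open Polynomial

namespace AbhyankarMohSuzuki

/-! ### Integer-valued degree functions on fields -/

section DegreeFunction

variable {E : Type*} [Field E]

/-- An integer-valued function satisfying the rules of a degree away from zero. -/
structure IsDegree (v : E → ℤ) : Prop where
  mul : ∀ x y, x ≠ 0 → y ≠ 0 → v (x * y) = v x + v y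
  add_le : ∀ x y, x ≠ 0 → y ≠ 0 → x + y ≠ 0 → v (x + y) ≤ max (v x) (v y)

/-- The element `x` is zero or of degree at most `k`. -/
def HasBound (v : E → ℤ) (k : ℤ) (x : E) : Prop := x ≠ 0 → v x ≤ k

theorem HasBound.mono {v : E → ℤ} {k l : ℤ} {x : E} (h : HasBound v k x) (hkl : k ≤ l) :
    HasBound v l x := fun hx => (h hx).trans hkl

namespace IsDegree

variable {v : E → ℤ}

theorem one (hv : IsDegree v) : v 1 = 0 := by
  have := hv.mul 1 1 one_ne_zero one_ne_zero
  rw [mul_one] at this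
  omega

theorem neg (hv : IsDegree v) (x : E) : v (-x) = v x := by
  by_cases hx : x = 0
  · simp [hx]
  have h1 : (-1 : E) ≠ 0 := by simp
  have h2 := hv.mul (-1) (-1) h1 h1
  have h3 := hv.mul (-1) x h1 hx
  rw [neg_mul_neg, one_mul, hv.one] at h2
  rw [neg_one_mul] at h3
  omega

theorem pow (hv : IsDegree v) {x : E} (hx : x ≠ 0) (j : ℕ) : v (x ^ j) = j * v x := by
  induction j with
  | zero => simp [hv.one]
  | succ j ih =>
    rw [pow_succ, hv.mul _ _ (pow_ne_zero j hx) hx, ih]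
    push_cast
    ring

theorem bound_add (hv : IsDegree v) {k : ℤ} {x y : E} (hx : HasBound v k x) (hy : HasBound v k y) :
    HasBound v k (x + y) := by
  intro h
  by_cases hx0 : x = 0
  · subst hx0
    rw [zero_add] at h ⊢
    exact hy h
  by_cases hy0 : y = 0
  · subst hy0
    rw [add_zero] at h ⊢
    exact hx h
  exact (hv.add_le x y hx0 hy0 h).trans (max_le (hx hx0) (hy hy0))

theorem bound_sub (hv : IsDegree v) {k : ℤ} {x y : E} (hx : HasBound v k x) (hy : HasBound v k y) :
    HasBound v k (x - y) := by
  rw [sub_eq_add_neg]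
  refine hv.bound_add hx fun h => ?_
  rw [hv.neg]
  exact hy (neg_ne_zero.mp h)

theorem bound_mul (hv : IsDegree v)
    {k l : ℤ} {x y : E} (hx : HasBound v k x) (hy : HasBound v l y) :
    HasBound v (k + l) (x * y) := by
  intro h
  have h1 := left_ne_zero_of_mul h
  have h2 := right_ne_zero_of_mul h
  rw [hv.mul x y h1 h2]
  exact add_le_add (hx h1) (hy h2)

theorem add_eq_right (hv : IsDegree v) {x y : E} (hy : y ≠ 0) (h : x ≠ 0 → v x < v y) :
    x + y ≠ 0 ∧ v (x + y) = v y := by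
  by_cases hx : x = 0
  · simp [hx, hy]
  have hlt := h hx
  have hxy : x + y ≠ 0 := by
    intro h0
    rw [← neg_eq_of_add_eq_zero_right h0, hv.neg] at hlt
    exact lt_irrefl _ hlt
  refine ⟨hxy, le_antisymm ((hv.add_le x y hx hy hxy).trans (max_le hlt.le le_rfl)) ?_⟩
  have h1 := hv.add_le (x + y) (-x) hxy (neg_ne_zero.mpr hx) (by simpa using hy)
  rw [hv.neg, add_neg_cancel_comm] at h1
  rcases le_max_iff.mp h1 with h2 | h2
  · exact h2
  · exact absurd h2 (not_le.mpr hlt)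

theorem bound_of_add (hv : IsDegree v) {k : ℤ} {x y : E} (hne : x ≠ 0 → y ≠ 0 → v x ≠ v y)
    (h : HasBound v k (x + y)) : HasBound v k x ∧ HasBound v k y := by
  by_cases hx : x = 0
  · subst hx
    rw [zero_add] at h
    exact ⟨fun h0 => absurd rfl h0, h⟩
  by_cases hy : y = 0
  · subst hy
    rw [add_zero] at h
    exact ⟨h, fun h0 => absurd rfl h0⟩
  rcases lt_or_gt_of_ne (hne hx hy) with hlt | hlt
  · obtain ⟨h1, h2⟩ := hv.add_eq_right hy fun _ => hlt
    have := h h1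
    exact ⟨fun _ => by omega, fun _ => by omega⟩
  · obtain ⟨h1, h2⟩ := hv.add_eq_right hx fun _ => hlt
    rw [add_comm] at h1 h2
    have := h h1
    exact ⟨fun _ => by omega, fun _ => by omega⟩

/-- The degree of a sum of terms with pairwise distinct degrees is the largest of these degrees. -/
theorem sum_of_pairwise_ne (hv : IsDegree v) {ι : Type*} (s : Finset ι) (x : ι → E)
    (h : ∀ i ∈ s, ∀ j ∈ s, x i ≠ 0 → x j ≠ 0 → v (x i) = v (x j) → i = j) :
    (∀ i ∈ s, x i = 0) ∨ ∃ i ∈ s, x i ≠ 0 ∧ ∑ j ∈ s, x j ≠ 0 ∧ v (∑ j ∈ s, x j) = v (x i) ∧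
      ∀ j ∈ s, x j ≠ 0 → v (x j) ≤ v (x i) := by
  classical
  induction s using Finset.induction_on with
  | empty => simp
  | insert a s ha ih =>
    rw [Finset.sum_insert ha]
    by_cases hxa : x a = 0
    · rcases ih fun i hi j hj => h i (Finset.mem_insert_of_mem hi) j (Finset.mem_insert_of_mem hj)
        with h0 | ⟨i, hi, hxi, hs, hvs, hle⟩
      · left
        simpa [hxa] using h0
      · right
        exact ⟨i, Finset.mem_insert_of_mem hi, hxi, by simpa [hxa] using hs,
          by simpa [hxa] using hvs, by simpa [hxa] using hle⟩
    right
    rcases ih fun i hi j hj => h i (Finset.mem_insert_of_mem hi) j (Finset.mem_insert_of_mem hj)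
      with h0 | ⟨i, hi, hxi, hs, hvs, hle⟩
    · refine ⟨a, Finset.mem_insert_self a s, hxa, ?_⟩
      rw [Finset.sum_eq_zero h0, add_zero]
      refine ⟨hxa, rfl, fun j hj hxj => ?_⟩
      rcases Finset.mem_insert.mp hj with rfl | hj
      · exact le_rfl
      · exact absurd (h0 j hj) hxj
    have hia : v (x i) ≠ v (x a) := fun he =>
      ha (h i (Finset.mem_insert_of_mem hi) a (Finset.mem_insert_self a s) hxi hxa he ▸ hi)
    rcases lt_or_gt_of_ne hia with hlt | hlt
    · obtain ⟨h1, h2⟩ := hv.add_eq_right (x := ∑ j ∈ s, x j) hxa fun _ => hvs ▸ hlt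
      rw [add_comm] at h1 h2
      refine ⟨a, Finset.mem_insert_self a s, hxa, h1, h2, fun j hj hxj => ?_⟩
      rcases Finset.mem_insert.mp hj with rfl | hj
      · exact le_rfl
      · exact (hle j hj hxj).trans hlt.le
    · obtain ⟨h1, h2⟩ := hv.add_eq_right (x := x a) hs fun _ => hvs.symm ▸ hlt
      refine ⟨i, Finset.mem_insert_of_mem hi, hxi, h1, h2.trans hvs, fun j hj hxj => ?_⟩
      rcases Finset.mem_insert.mp hj with rfl | hj
      · exact hlt.le
      · exact hle j hj hxj

end IsDegree

end DegreeFunction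

/-! ### Expansions in powers of a monic polynomial -/

section Digits

variable {R : Type*} [CommRing R]

/-- The polynomial `c` over `R[X]` has coefficients of degree smaller than that of `Φ`, so that
`c.eval Φ` is an expansion in powers of `Φ`. -/
def IsDigits (Φ : R[X]) (c : R[X][X]) : Prop := ∀ j, (c.coeff j).degree < Φ.degree

theorem exists_isDigits [Nontrivial R] {Φ : R[X]} (hΦ : Φ.Monic) (hD : 0 < Φ.natDegree)
    (T : R[X]) : ∃ c, IsDigits Φ c ∧ c.eval Φ = T := by
  induction h : T.natDegree using Nat.strong_induction_on generalizing T with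
  | _ N ih =>
    have hΦ0 : (0 : WithBot ℕ) < Φ.degree := natDegree_pos_iff_degree_pos.mp hD
    by_cases hT : T.degree < Φ.degree
    · refine ⟨C T, fun j => ?_, eval_C⟩
      rw [coeff_C]
      split_ifs
      · exact hT
      · rw [degree_zero]
        exact bot_lt_iff_ne_bot.mpr (ne_bot_of_gt hΦ0)
    obtain ⟨c, hc, hcT⟩ := ih (T /ₘ Φ).natDegree (by
      rw [← h, natDegree_divByMonic T hΦ]
      have := natDegree_le_natDegree (not_lt.mp hT)
      omega) _ rfl
    refine ⟨X * c + C (T %ₘ Φ), fun j => ?_, ?_⟩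
    · cases j with
      | zero => simpa using degree_modByMonic_lt T hΦ
      | succ j => simpa using hc j
    · rw [eval_add, eval_mul, eval_X, eval_C, hcT, add_comm, modByMonic_add_div]

theorem IsDigits.degree_eval_lt [Nontrivial R] {Φ : R[X]} (hΦ : Φ.Monic) {c : R[X][X]}
    (hc : IsDigits Φ c) {N : ℕ} (hN : c.degree < N) :
    (c.eval Φ).degree < ((N * Φ.natDegree : ℕ) : WithBot ℕ) := by
  rw [eval_eq_sum, sum_def, ← mem_degreeLT]
  refine Submodule.sum_mem _ fun j hj => mem_degreeLT.mpr ?_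
  have hjN : j < N := by
    exact_mod_cast (le_degree_of_mem_supp j hj).trans_lt hN
  by_cases h0 : c.coeff j = 0
  · rw [h0, zero_mul, degree_zero]
    exact WithBot.bot_lt_coe _
  have h1 := natDegree_lt_natDegree h0 (hc j)
  refine degree_le_natDegree.trans_lt ?_
  have h2 := natDegree_mul_le (p := c.coeff j) (q := Φ ^ j)
  rw [hΦ.natDegree_pow] at h2
  have h3 : (j + 1) * Φ.natDegree ≤ N * Φ.natDegree := Nat.mul_le_mul_right _ hjN
  rw [add_mul] at h3
  exact_mod_cast (by omega : (c.coeff j * Φ ^ j).natDegree < N * Φ.natDegree)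

theorem IsDigits.degree_lt [Nontrivial R] {Φ : R[X]} (hΦ : Φ.Monic) {c : R[X][X]}
    (hc : IsDigits Φ c) {N : ℕ}
    (hN : (c.eval Φ).degree < ((N * Φ.natDegree : ℕ) : WithBot ℕ)) : c.degree < N := by
  by_contra! hle
  have hc0 : c ≠ 0 := by
    rintro rfl
    simp at hle
  have hNM : N ≤ c.natDegree := le_natDegree_of_coe_le_degree hle
  have hlow : IsDigits Φ c.eraseLead := fun j => by
    rw [eraseLead_coeff]
    split_ifs
    · exact degree_zero.trans_lt (bot_lt_iff_ne_bot.mpr (ne_bot_of_gt (hc 0)))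
    · exact hc j
  have h1 := hlow.degree_eval_lt hΦ (N := c.natDegree)
    (by rw [← degree_eq_natDegree hc0]; exact degree_eraseLead_lt hc0)
  have h2 : ((c.natDegree * Φ.natDegree : ℕ) : WithBot ℕ) ≤
      (c.leadingCoeff * Φ ^ c.natDegree).degree := by
    rw [(hΦ.pow _).degree_mul, degree_eq_natDegree (leadingCoeff_ne_zero.mpr hc0),
      degree_eq_natDegree (hΦ.pow _).ne_zero, hΦ.natDegree_pow]
    exact_mod_cast Nat.le_add_left _ _
  have h3 : c.eval Φ = c.eraseLead.eval Φ + c.leadingCoeff * Φ ^ c.natDegree := by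
    conv_lhs => rw [← eraseLead_add_monomial_natDegree_leadingCoeff c]
    rw [eval_add, eval_monomial]
  rw [h3, degree_add_eq_right_of_degree_lt (h1.trans_le h2)] at hN
  have h4 : ((N * Φ.natDegree : ℕ) : WithBot ℕ) ≤ ((c.natDegree * Φ.natDegree : ℕ) : WithBot ℕ) :=
    by exact_mod_cast Nat.mul_le_mul_right _ hNM
  exact absurd (h4.trans h2) (not_le.mpr hN)

end Digits

/-! ### Approximate roots -/

section ApproximateRoot

variable {R : Type*} [CommRing R] [Nontrivial R]

theorem degree_pow_sub_pow_lt {Φ Ψ : R[X]} (hΦ : Φ.Monic) (hΨ : Ψ.Monic) {D : ℕ}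
    (hΦD : Φ.natDegree = D) (hΨD : Ψ.natDegree = D) (i : ℕ) :
    (Φ ^ i - Ψ ^ i).degree < ((i * D : ℕ) : WithBot ℕ) := by
  have h1 : (Φ ^ i).degree = ((i * D : ℕ) : WithBot ℕ) := by
    rw [degree_eq_natDegree (hΦ.pow i).ne_zero, hΦ.natDegree_pow, hΦD]
  have h2 : (Ψ ^ i).degree = ((i * D : ℕ) : WithBot ℕ) := by
    rw [degree_eq_natDegree (hΨ.pow i).ne_zero, hΨ.natDegree_pow, hΨD]
  rw [← h1]
  exact degree_sub_lt_left (h1.trans h2.symm) (hΦ.pow i).ne_zero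
    ((hΦ.pow i).leadingCoeff.trans (hΨ.pow i).leadingCoeff.symm)

theorem degree_geom_sum_sub_lt {Φ Ψ : R[X]} (hΦ : Φ.Monic) (hΨ : Ψ.Monic) {D : ℕ}
    (hΦD : Φ.natDegree = D) (hΨD : Ψ.natDegree = D) (d : ℕ) :
    (∑ i ∈ Finset.range d, Φ ^ i * Ψ ^ (d - 1 - i) - C (d : R) * Ψ ^ (d - 1)).degree <
      (((d - 1) * D : ℕ) : WithBot ℕ) := by
  have h1 : C (d : R) * Ψ ^ (d - 1) = ∑ i ∈ Finset.range d, Ψ ^ i * Ψ ^ (d - 1 - i) := by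
    rw [Finset.sum_congr rfl fun i hi => ?_, Finset.sum_const, Finset.card_range, nsmul_eq_mul,
      C_eq_natCast]
    have := Finset.mem_range.mp hi
    rw [← pow_add]
    congr 1
    omega
  rw [h1, ← Finset.sum_sub_distrib, ← mem_degreeLT]
  refine Submodule.sum_mem _ fun i hi => mem_degreeLT.mpr ?_
  have hi := Finset.mem_range.mp hi
  rw [← sub_mul, (hΨ.pow _).degree_mul]
  have h2 : (Ψ ^ (d - 1 - i)).degree = (((d - 1 - i) * D : ℕ) : WithBot ℕ) := by
    rw [degree_eq_natDegree (hΨ.pow _).ne_zero, hΨ.natDegree_pow, hΨD]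
  have h3 : (d - 1) * D = i * D + (d - 1 - i) * D := by
    rw [← add_mul]
    congr 1
    omega
  rw [h2, h3, Nat.cast_add]
  exact WithBot.add_lt_add_right WithBot.coe_ne_bot
    (degree_pow_sub_pow_lt hΦ hΨ hΦD hΨD i)

/-- If a property of monic polynomials of degree `D` is stable under Tschirnhausen's operation
with respect to `P`, then it holds for the approximate `d`-th root of `P`. -/
theorem exists_approximateRoot {P : R[X]} (hP : P.Monic) {d D : ℕ} (hd : 0 < d)
    (hPD : P.natDegree = d * D) {r : R} (hr : (d : R) * r = 1) (G : R[X] → Prop)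
    (hG : ∀ Φ, G Φ → Φ.Monic ∧ Φ.natDegree = D)
    (hG' : ∀ Φ p, G Φ → p.degree < (D : WithBot ℕ) →
      (P - Φ ^ d - p * Φ ^ (d - 1)).degree < (((d - 1) * D : ℕ) : WithBot ℕ) → G (Φ + C r * p))
    (hne : ∃ Φ, G Φ) :
    ∃ Φ, G Φ ∧ (P - Φ ^ d).degree < (((d - 1) * D : ℕ) : WithBot ℕ) := by
  have hdD : d * D = (d - 1) * D + D := by
    rw [← Nat.succ_mul, Nat.succ_eq_add_one, Nat.sub_add_cancel hd]
  suffices H : ∀ k : ℕ, k ≤ D → ∃ Φ, G Φ ∧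
      (P - Φ ^ d).degree < (((d - 1) * D + (D - k) : ℕ) : WithBot ℕ) by
    simpa using H D le_rfl
  intro k
  induction k with
  | zero =>
    intro _
    obtain ⟨Φ, hΦ⟩ := hne
    obtain ⟨hm, hn⟩ := hG Φ hΦ
    refine ⟨Φ, hΦ, ?_⟩
    have h1 : (Φ ^ d).natDegree = P.natDegree := by rw [hm.natDegree_pow, hn, hPD]
    rw [Nat.sub_zero, ← hdD, ← hPD, ← degree_eq_natDegree hP.ne_zero]
    refine degree_sub_lt_left ?_ hP.ne_zero (hP.leadingCoeff.trans (hm.pow d).leadingCoeff.symm)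
    rw [degree_eq_natDegree hP.ne_zero, degree_eq_natDegree (hm.pow d).ne_zero, h1]
  | succ k ih =>
    intro hk
    obtain ⟨Φ, hΦ, hlt⟩ := ih (by omega)
    obtain ⟨hm, hn⟩ := hG Φ hΦ
    have hmd : (Φ ^ (d - 1)).natDegree = (d - 1) * D := by rw [hm.natDegree_pow, hn]
    have hmd' : (Φ ^ (d - 1)).degree = (((d - 1) * D : ℕ) : WithBot ℕ) := by
      rw [degree_eq_natDegree (hm.pow _).ne_zero, hmd]
    set p := (P - Φ ^ d) /ₘ Φ ^ (d - 1) with hp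
    have hrem : P - Φ ^ d - p * Φ ^ (d - 1) = (P - Φ ^ d) %ₘ Φ ^ (d - 1) := by
      rw [modByMonic_eq_sub_mul_div, mul_comm]
    have hremlt : (P - Φ ^ d - p * Φ ^ (d - 1)).degree < (((d - 1) * D : ℕ) : WithBot ℕ) := by
      rw [hrem, ← hmd']
      exact degree_modByMonic_lt _ (hm.pow _)
    have hpk : p.degree < ((D - k : ℕ) : WithBot ℕ) := by
      by_cases hp0 : p = 0
      · rw [hp0, degree_zero]
        exact WithBot.bot_lt_coe _
      have h1 : (p * Φ ^ (d - 1)).degree < (((d - 1) * D + (D - k) : ℕ) : WithBot ℕ) := by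
        have h2 : p * Φ ^ (d - 1) = (P - Φ ^ d) - (P - Φ ^ d - p * Φ ^ (d - 1)) := by ring
        rw [h2]
        refine (degree_sub_le _ _).trans_lt (max_lt hlt (hremlt.trans_le ?_))
        exact_mod_cast Nat.le_add_right _ _
      rw [(hm.pow _).degree_mul, hmd', degree_eq_natDegree hp0] at h1
      rw [degree_eq_natDegree hp0]
      have h3 : p.natDegree + (d - 1) * D < (d - 1) * D + (D - k) := by exact_mod_cast h1
      exact_mod_cast (by omega : p.natDegree < D - k)
    have hG1 := hG' Φ p hΦ (hpk.trans_le (by exact_mod_cast Nat.sub_le _ _)) hremlt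
    obtain ⟨hm1, hn1⟩ := hG _ hG1
    refine ⟨_, hG1, ?_⟩
    have hgeom := geom_sum₂_mul (Φ + C r * p) Φ d
    set S := ∑ i ∈ Finset.range d, (Φ + C r * p) ^ i * Φ ^ (d - 1 - i) with hS
    have hkey : P - (Φ + C r * p) ^ d =
        (P - Φ ^ d - p * Φ ^ (d - 1)) - (S - C (d : R) * Φ ^ (d - 1)) * (C r * p) := by
      have h4 : C (d : R) * C r = 1 := by rw [← C_mul, hr, C_1]
      linear_combination (-Φ ^ (d - 1) * p) * h4 + hgeom
    rw [hkey]
    refine (degree_sub_le _ _).trans_lt (max_lt (hremlt.trans_le ?_) ?_)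
    · exact_mod_cast Nat.le_add_right _ _
    have hS1 := degree_geom_sum_sub_lt hm1 hm hn1 hn d
    rw [← hS] at hS1
    by_cases h0 : (S - C (d : R) * Φ ^ (d - 1)) * (C r * p) = 0
    · rw [h0, degree_zero]
      exact WithBot.bot_lt_coe _
    have hl := natDegree_lt_natDegree (left_ne_zero_of_mul h0) (hS1.trans_eq hmd'.symm)
    rw [hmd] at hl
    have hr2 : p.natDegree < D - k := by
      have hp0 : p ≠ 0 := fun h => h0 (by rw [h, mul_zero, mul_zero])
      rw [degree_eq_natDegree hp0] at hpk
      exact_mod_cast hpk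
    have h5 := natDegree_mul_le (p := S - C (d : R) * Φ ^ (d - 1)) (q := C r * p)
    have h6 := natDegree_C_mul_le r p
    rw [degree_eq_natDegree h0]
    exact_mod_cast (by omega :
      ((S - C (d : R) * Φ ^ (d - 1)) * (C r * p)).natDegree < (d - 1) * D + (D - (k + 1)))

theorem approximateRoot_unique {F : Type*} [Field F] {P Φ Ψ : F[X]} {d D : ℕ}
    (hd : (d : F) ≠ 0) (hΦ : Φ.Monic) (hΨ : Ψ.Monic) (hΦD : Φ.natDegree = D)
    (hΨD : Ψ.natDegree = D) (h1 : (P - Φ ^ d).degree < (((d - 1) * D : ℕ) : WithBot ℕ))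
    (h2 : (P - Ψ ^ d).degree < (((d - 1) * D : ℕ) : WithBot ℕ)) : Φ = Ψ := by
  by_contra hne
  have hgeom := geom_sum₂_mul Φ Ψ d
  have hS := degree_geom_sum_sub_lt hΦ hΨ hΦD hΨD d
  set S := ∑ i ∈ Finset.range d, Φ ^ i * Ψ ^ (d - 1 - i)
  have h3 : (C (d : F) * Ψ ^ (d - 1)).degree = (((d - 1) * D : ℕ) : WithBot ℕ) := by
    rw [degree_C_mul hd, degree_eq_natDegree (hΨ.pow _).ne_zero, hΨ.natDegree_pow, hΨD]
  have h4 : S.degree = (((d - 1) * D : ℕ) : WithBot ℕ) := by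
    rw [← h3, ← sub_add_cancel S (C (d : F) * Ψ ^ (d - 1))]
    exact degree_add_eq_right_of_degree_lt (hS.trans_eq h3.symm)
  have h5 : (Φ ^ d - Ψ ^ d).degree < (((d - 1) * D : ℕ) : WithBot ℕ) := by
    rw [show Φ ^ d - Ψ ^ d = (P - Ψ ^ d) - (P - Φ ^ d) by ring]
    exact (degree_sub_le _ _).trans_lt (max_lt h2 h1)
  rw [← hgeom, degree_mul, h4, degree_eq_natDegree (sub_ne_zero.mpr hne)] at h5
  have h6 : (d - 1) * D + (Φ - Ψ).natDegree < (d - 1) * D := by exact_mod_cast h5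
  omega

end ApproximateRoot

/-! ### Key polynomials -/

theorem exists_index_of_not_dvd {d : ℕ} (hd : 0 < d) {δ : ℤ} (h : ¬(d : ℤ) ∣ δ) :
    ∃ d' e : ℕ, d = d' * e ∧ 1 < e ∧ 0 < d' ∧ (d' : ℤ) ∣ δ ∧
      ∀ j : ℤ, (d : ℤ) ∣ j * δ → (e : ℤ) ∣ j := by
  obtain ⟨γ, hγ⟩ : ∃ γ, γ = Int.gcd d δ := ⟨_, rfl⟩
  have hγ0 : 0 < γ := hγ ▸ Int.gcd_pos_of_ne_zero_left _ (by omega)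
  obtain ⟨e, he⟩ : γ ∣ d := by
    rw [hγ]
    exact_mod_cast Int.gcd_dvd_left (d : ℤ) δ
  obtain ⟨s, hs⟩ : (γ : ℤ) ∣ δ := hγ ▸ Int.gcd_dvd_right (d : ℤ) δ
  have he' : (d : ℤ) = γ * e := by exact_mod_cast he
  refine ⟨γ, e, he, ?_, hγ0, ⟨s, hs⟩, fun j hj => ?_⟩
  · by_contra! hle
    interval_cases e
    · omega
    · exact h ⟨s, by rw [hs, he', Nat.cast_one, mul_one]⟩
  · have hcop : IsCoprime (e : ℤ) s := by
      rw [Int.isCoprime_iff_gcd_eq_one]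
      rw [he', hs, Int.gcd_mul_left, Int.natAbs_natCast] at hγ
      exact (Nat.mul_eq_left hγ0.ne').mp hγ.symm
    refine hcop.dvd_of_dvd_mul_right ?_
    rw [he', hs, mul_left_comm] at hj
    exact Int.dvd_of_mul_dvd_mul_left (by exact_mod_cast hγ0.ne') hj

section Key

variable {A F E : Type*} [CommRing A] [Field F] [Field E] [Algebra A F]

/-- The situation of two generators `f`, `g` of `K[z]`: here `A` is `K[f]`, `F` is `K(f)`, `E` is
`K(z)` with its degree `v`, `n` is the degree of `f`, `ev` is evaluation at `g` and `P` is the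
minimal polynomial of `g`. -/
structure IsLine (ev : F[X] →+* E) (v : E → ℤ) (P : A[X]) (n : ℕ) : Prop where
  pos : 0 < n
  isDegree : IsDegree v
  natCast : ∀ d : ℕ, d ≠ 0 → v d = 0
  isUnit : ∀ d : ℕ, d ≠ 0 → IsUnit (d : A)
  monic : P.Monic
  natDegree : P.natDegree = n
  root : ev (P.map (algebraMap A F)) = 0
  ne_zero : ∀ T : F[X], T ≠ 0 → T.degree < n → ev T ≠ 0
  dvd_C : ∀ c : F, c ≠ 0 → (n : ℤ) ∣ v (ev (C c))
  exists_not_dvd : ∀ d D : ℕ, d * D = n → 1 < d →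
    ∃ T : F[X], T ≠ 0 ∧ T.natDegree ≤ D ∧ ¬(d : ℤ) ∣ v (ev T)
  nonneg : ∀ T : A[X], ev (T.map (algebraMap A F)) ≠ 0 → 0 ≤ v (ev (T.map (algebraMap A F)))
  surjective : ∀ k : ℕ, ∃ T : A[X], T.degree < n ∧ T.map (algebraMap A F) ≠ 0 ∧
    v (ev (T.map (algebraMap A F))) = k

/-- All values of polynomials of degree less than `D` have degree divisible by `d = n / D`. -/
structure IsLevel (ev : F[X] →+* E) (v : E → ℤ) (n d D : ℕ) : Prop where
  mul_eq : d * D = n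
  dvd : ∀ T : F[X], T ≠ 0 → T.degree < D → (d : ℤ) ∣ v (ev T)

/-- A monic polynomial of degree `D` whose value has degree not divisible by `d`. -/
structure IsKey (ev : F[X] →+* E) (v : E → ℤ) (d D : ℕ) (Φ : F[X]) : Prop where
  monic : Φ.Monic
  natDegree : Φ.natDegree = D
  not_dvd : ¬(d : ℤ) ∣ v (ev Φ)

/-- All terms of the expansion of `T` in powers of `Φ` have values of degree at most `k`. -/
def HasWeight (ev : F[X] →+* E) (v : E → ℤ) (Φ : F[X]) (k : ℤ) (T : F[X]) : Prop :=
  ∃ c, IsDigits Φ c ∧ c.eval Φ = T ∧ ∀ j : ℕ, HasBound v (k - j * v (ev Φ)) (ev (c.coeff j))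

variable {ev : F[X] →+* E} {v : E → ℤ} {P : A[X]} {n d D : ℕ} {Φ : F[X]}

theorem IsKey.degree (hΦ : IsKey ev v d D Φ) : Φ.degree = (D : WithBot ℕ) := by
  rw [degree_eq_natDegree hΦ.monic.ne_zero, hΦ.natDegree]

theorem IsKey.hasWeight_mul_pow (hΦ : IsKey ev v d D Φ) {a : F[X]} (ha : a.degree < D) {k : ℤ}
    (j : ℕ) (hk : HasBound v (k - j * v (ev Φ)) (ev a)) : HasWeight ev v Φ k (a * Φ ^ j) := by
  refine ⟨monomial j a, fun i => ?_, eval_monomial, fun i hi => ?_⟩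
  · rw [coeff_monomial, hΦ.degree]
    split_ifs
    · exact ha
    · exact degree_zero.trans_lt (WithBot.bot_lt_coe _)
  · rw [coeff_monomial] at hi ⊢
    split_ifs at hi ⊢ with hij
    · exact hij ▸ hk hi
    · exact absurd (map_zero ev) hi

namespace IsLine

theorem pos_of_isLevel (h : IsLine ev v P n) (hL : IsLevel ev v n d D) : 0 < d ∧ 0 < D := by
  have := hL.mul_eq ▸ h.pos
  exact ⟨pos_of_mul_pos_left this (Nat.zero_le _), pos_of_mul_pos_right this (Nat.zero_le _)⟩

theorem le_of_isLevel (h : IsLine ev v P n) (hL : IsLevel ev v n d D) : D ≤ n :=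
  hL.mul_eq ▸ Nat.le_mul_of_pos_left D (h.pos_of_isLevel hL).1

theorem one_lt_of_isKey (h : IsLine ev v P n)
    (hL : IsLevel ev v n d D) (hΦ : IsKey ev v d D Φ) : 1 < d := by
  have h1 := (h.pos_of_isLevel hL).1
  have h2 : d ≠ 1 := by
    rintro rfl
    exact hΦ.not_dvd (by simp)
  omega

theorem ev_ne_zero_of_degree_lt (h : IsLine ev v P n)
    (hL : IsLevel ev v n d D) {T : F[X]} (hT : T ≠ 0)
    (hTD : T.degree < D) : ev T ≠ 0 :=
  h.ne_zero T hT (hTD.trans_le (by exact_mod_cast h.le_of_isLevel hL))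

theorem ev_key_ne_zero (h : IsLine ev v P n)
    (hL : IsLevel ev v n d D) (hΦ : IsKey ev v d D Φ) : ev Φ ≠ 0 := by
  refine h.ne_zero Φ hΦ.monic.ne_zero ?_
  rw [hΦ.degree, ← hL.mul_eq]
  have := h.one_lt_of_isKey hL hΦ
  have := (h.pos_of_isLevel hL).2
  exact_mod_cast (by nlinarith : D < d * D)

theorem v_mul_key_pow (h : IsLine ev v P n)
    (hL : IsLevel ev v n d D) (hΦ : IsKey ev v d D Φ) {a : F[X]} (ha : a ≠ 0)
    (haD : a.degree < D) (j : ℕ) :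
    ev (a * Φ ^ j) ≠ 0 ∧ v (ev (a * Φ ^ j)) = v (ev a) + j * v (ev Φ) := by
  have h1 := h.ev_ne_zero_of_degree_lt hL ha haD
  have h2 := h.ev_key_ne_zero hL hΦ
  rw [map_mul, map_pow]
  exact ⟨mul_ne_zero h1 (pow_ne_zero j h2),
    by rw [h.isDegree.mul _ _ h1 (pow_ne_zero j h2), h.isDegree.pow h2]⟩

/-- The degree of the value of `c.eval Φ` is the largest of the degrees of the values of its terms,
when the number of terms is at most the order of the degree of `Φ` modulo `d`. -/
theorem exists_coeff_eq (h : IsLine ev v P n)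
    (hL : IsLevel ev v n d D) (hΦ : IsKey ev v d D Φ) {e : ℕ}
    (he : ∀ j : ℤ, (d : ℤ) ∣ j * v (ev Φ) → (e : ℤ) ∣ j) {c : F[X][X]} (hc : IsDigits Φ c)
    (hlt : (c.eval Φ).degree < ((e * D : ℕ) : WithBot ℕ)) (h0 : c.eval Φ ≠ 0) :
    ∃ i < e, c.coeff i ≠ 0 ∧ v (ev (c.eval Φ)) = v (ev (c.coeff i)) + i * v (ev Φ) ∧
      ∀ j, c.coeff j ≠ 0 → v (ev (c.coeff j)) + j * v (ev Φ) ≤ v (ev (c.eval Φ)) := by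
  have hce : c.degree < e := hc.degree_lt hΦ.monic (by rwa [hΦ.natDegree])
  have hc0 : c ≠ 0 := by
    rintro rfl
    simp at h0
  have hcn : c.natDegree < e := by
    rw [degree_eq_natDegree hc0] at hce
    exact_mod_cast hce
  have hcD : ∀ j, (c.coeff j).degree < D := fun j => hΦ.degree ▸ hc j
  have hval := fun j (hj : c.coeff j ≠ 0) => h.v_mul_key_pow hL hΦ hj (hcD j) j
  have hsum : ev (c.eval Φ) = ∑ i ∈ Finset.range e, ev (c.coeff i * Φ ^ i) := by
    rw [eval_eq_sum_range' hcn, map_sum]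
  have hcoeff : ∀ j, ev (c.coeff j * Φ ^ j) ≠ 0 → c.coeff j ≠ 0 := fun j hj h1 => by
    simp [h1] at hj
  rcases h.isDegree.sum_of_pairwise_ne (Finset.range e) (fun i => ev (c.coeff i * Φ ^ i))
    (by
      intro i hi j hj hi0 hj0 hij
      have hi := Finset.mem_range.mp hi
      have hj := Finset.mem_range.mp hj
      rw [(hval i (hcoeff i hi0)).2, (hval j (hcoeff j hj0)).2] at hij
      have h1 : (d : ℤ) ∣ ((i : ℤ) - j) * v (ev Φ) := by
        rw [show ((i : ℤ) - j) * v (ev Φ) = v (ev (c.coeff j)) - v (ev (c.coeff i)) by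
          linear_combination hij]
        exact dvd_sub (hL.dvd _ (hcoeff j hj0) (hcD j)) (hL.dvd _ (hcoeff i hi0) (hcD i))
      have h2 := Int.eq_zero_of_abs_lt_dvd (he _ h1) (by rw [abs_lt]; omega)
      omega) with hz | ⟨i, hi, hi0, hs, hvs, hle⟩
  · exfalso
    refine hc0 (Polynomial.ext fun j => ?_)
    rw [coeff_zero]
    by_contra hj
    have hje : j < e := (le_natDegree_of_ne_zero hj).trans_lt hcn
    exact (hval j hj).1 (hz j (Finset.mem_range.mpr hje))
  · refine ⟨i, Finset.mem_range.mp hi, hcoeff i hi0, ?_, fun j hj => ?_⟩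
    · rw [hsum, hvs, (hval i (hcoeff i hi0)).2]
    · have hje : j < e := (le_natDegree_of_ne_zero hj).trans_lt hcn
      rw [hsum, hvs, ← (hval j hj).2]
      exact hle j (Finset.mem_range.mpr hje) (hval j hj).1

theorem exists_coeff_eq' (h : IsLine ev v P n)
    (hL : IsLevel ev v n d D) (hΦ : IsKey ev v d D Φ) {e : ℕ}
    (he : ∀ j : ℤ, (d : ℤ) ∣ j * v (ev Φ) → (e : ℤ) ∣ j) {T : F[X]}
    (hlt : T.degree < ((e * D : ℕ) : WithBot ℕ)) (h0 : T ≠ 0) :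
    ∃ c, IsDigits Φ c ∧ c.eval Φ = T ∧
      ∃ i < e, c.coeff i ≠ 0 ∧ v (ev T) = v (ev (c.coeff i)) + i * v (ev Φ) ∧
        ∀ j, c.coeff j ≠ 0 → v (ev (c.coeff j)) + j * v (ev Φ) ≤ v (ev T) := by
  obtain ⟨c, hc, rfl⟩ :=
    exists_isDigits hΦ.monic (hΦ.natDegree.symm ▸ (h.pos_of_isLevel hL).2) T
  exact ⟨c, hc, rfl, h.exists_coeff_eq hL hΦ he hc hlt h0⟩

theorem isLevel_mul (h : IsLine ev v P n)
    (hL : IsLevel ev v n d D) (hΦ : IsKey ev v d D Φ) {d' e : ℕ}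
    (hde : d = d' * e) (hd' : (d' : ℤ) ∣ v (ev Φ))
    (he : ∀ j : ℤ, (d : ℤ) ∣ j * v (ev Φ) → (e : ℤ) ∣ j) : IsLevel ev v n d' (e * D) where
  mul_eq := by rw [← mul_assoc, ← hde, hL.mul_eq]
  dvd T hT hTD := by
    obtain ⟨c, hc, -, i, -, hi, hvT, -⟩ := h.exists_coeff_eq' hL hΦ he hTD hT
    rw [hvT]
    have h1 : (d' : ℤ) ∣ d := by exact_mod_cast Dvd.intro e hde.symm
    exact dvd_add (h1.trans (hL.dvd _ hi (hΦ.degree ▸ hc i))) (hd'.mul_left _)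

theorem hasWeight_self (h : IsLine ev v P n)
    (hL : IsLevel ev v n d D) (hΦ : IsKey ev v d D Φ) {e : ℕ}
    (he : ∀ j : ℤ, (d : ℤ) ∣ j * v (ev Φ) → (e : ℤ) ∣ j) {T : F[X]}
    (hlt : T.degree < ((e * D : ℕ) : WithBot ℕ)) {k : ℤ} (hk : HasBound v k (ev T))
    (hne : T ≠ 0 → ev T ≠ 0) : HasWeight ev v Φ k T := by
  by_cases h0 : T = 0
  · refine ⟨0, fun j => ?_, by simp [h0], fun j hj => absurd (by simp) hj⟩
    rw [coeff_zero, degree_zero, hΦ.degree]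
    exact WithBot.bot_lt_coe _
  obtain ⟨c, hc, hcT, -, -, -, -, hle⟩ := h.exists_coeff_eq' hL hΦ he hlt h0
  refine ⟨c, hc, hcT, fun j hj => ?_⟩
  have h1 := hle j fun h2 => hj (by rw [h2, map_zero])
  have h2 := hk (hne h0)
  omega

theorem hasWeight_add (h : IsLine ev v P n) {k : ℤ} {T U : F[X]} (hT : HasWeight ev v Φ k T)
    (hU : HasWeight ev v Φ k U) : HasWeight ev v Φ k (T + U) := by
  obtain ⟨c, hc, rfl, hcb⟩ := hT
  obtain ⟨c', hc', rfl, hcb'⟩ := hU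
  refine ⟨c + c', fun j => ?_, eval_add, fun j => ?_⟩
  · rw [coeff_add]
    exact (degree_add_le _ _).trans_lt (max_lt (hc j) (hc' j))
  · rw [coeff_add, map_add]
    exact h.isDegree.bound_add (hcb j) (hcb' j)

theorem hasWeight_sum (h : IsLine ev v P n)
    (hΦ : IsKey ev v d D Φ) {k : ℤ} {ι : Type*} (s : Finset ι) (T : ι → F[X])
    (hT : ∀ i ∈ s, HasWeight ev v Φ k (T i)) : HasWeight ev v Φ k (∑ i ∈ s, T i) := by
  refine Finset.sum_induction T _ (fun _ _ => h.hasWeight_add) ?_ hT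
  rw [← zero_mul (Φ ^ 0)]
  refine hΦ.hasWeight_mul_pow ?_ 0 fun h0 => absurd (map_zero ev) h0
  rw [degree_zero]
  exact WithBot.bot_lt_coe _

theorem hasWeight_mul (h : IsLine ev v P n)
    (hL : IsLevel ev v n d D) (hΦ : IsKey ev v d D Φ) {k l : ℤ} {T U : F[X]}
    (hT : HasWeight ev v Φ k T) (hU : HasWeight ev v Φ l U) :
    HasWeight ev v Φ (k + l) (T * U) := by
  obtain ⟨c, hc, rfl, hcb⟩ := hT
  obtain ⟨c', hc', rfl, hcb'⟩ := hU
  rw [eval_eq_sum_range, eval_eq_sum_range, Finset.sum_mul_sum]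
  refine h.hasWeight_sum hΦ _ _ fun i _ => h.hasWeight_sum hΦ _ _ fun j _ => ?_
  have hD := (h.pos_of_isLevel hL).2
  set q := (c.coeff i * c'.coeff j) /ₘ Φ with hq
  set r := (c.coeff i * c'.coeff j) %ₘ Φ with hr
  have hdiv : r + Φ * q = c.coeff i * c'.coeff j := modByMonic_add_div _ _
  have hrD : r.degree < D := hΦ.degree ▸ degree_modByMonic_lt _ hΦ.monic
  have hqD : q.degree < D := by
    refine degree_le_natDegree.trans_lt ?_
    rw [hq, natDegree_divByMonic _ hΦ.monic, hΦ.natDegree]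
    have h1 := natDegree_mul_le (p := c.coeff i) (q := c'.coeff j)
    have h2 : ∀ T : F[X], T.degree < Φ.degree → T.natDegree < D := fun T hT => by
      rw [← hΦ.natDegree]
      by_cases hT0 : T = 0
      · rw [hT0, natDegree_zero, hΦ.natDegree]
        exact hD
      · exact natDegree_lt_natDegree hT0 hT
    have h3 := h2 _ (hc i)
    have h4 := h2 _ (hc' j)
    exact_mod_cast (by omega : (c.coeff i * c'.coeff j).natDegree - D < D)
  have hb := h.isDegree.bound_mul (hcb i) (hcb' j)
  rw [← map_mul, ← hdiv, map_add] at hb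
  have hval : q ≠ 0 → v (ev (Φ * q)) = v (ev q) + v (ev Φ) := fun hq0 => by
    have := (h.v_mul_key_pow hL hΦ hq0 hqD 1).2
    rw [pow_one, mul_comm] at this
    rw [this]
    push_cast
    ring
  obtain ⟨hbr, hbq⟩ := h.isDegree.bound_of_add (fun hr0 hq0 hrq => by
    have hr0 : r ≠ 0 := fun h0 => hr0 (by rw [h0, map_zero])
    have hq0 : q ≠ 0 := fun h0 => hq0 (by rw [h0, mul_zero, map_zero])
    rw [hval hq0] at hrq
    apply hΦ.not_dvd
    rw [← sub_eq_iff_eq_add'.mpr hrq]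
    exact dvd_sub (hL.dvd r hr0 hrD) (hL.dvd q hq0 hqD)) hb
  rw [show c.coeff i * Φ ^ i * (c'.coeff j * Φ ^ j) = r * Φ ^ (i + j) + q * Φ ^ (i + j + 1) by
    linear_combination (-Φ ^ (i + j)) * hdiv]
  refine h.hasWeight_add (hΦ.hasWeight_mul_pow hrD _ (hbr.mono ?_))
    (hΦ.hasWeight_mul_pow hqD _ fun hq0 => ?_)
  · push_cast
    linarith
  · have hq0' : q ≠ 0 := fun h0 => hq0 (by rw [h0, map_zero])
    have h1 := hbq (by rw [map_mul]; exact mul_ne_zero (h.ev_key_ne_zero hL hΦ) hq0)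
    rw [hval hq0'] at h1
    push_cast
    linarith

theorem hasWeight_pow (h : IsLine ev v P n)
    (hL : IsLevel ev v n d D) (hΦ : IsKey ev v d D Φ) {k : ℤ} {T : F[X]}
    (hT : HasWeight ev v Φ k T) (j : ℕ) : HasWeight ev v Φ (j * k) (T ^ j) := by
  induction j with
  | zero =>
    have := hΦ.hasWeight_mul_pow (a := 1) (k := ((0 : ℕ) : ℤ) * k) (by
      rw [degree_one]
      exact_mod_cast (h.pos_of_isLevel hL).2) 0 fun _ => by simp [h.isDegree.one]
    simpa using this
  | succ j ih =>
    rw [pow_succ]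
    convert h.hasWeight_mul hL hΦ ih hT using 1
    push_cast
    ring
theorem exists_isKey (h : IsLine ev v P n)
    (hL : IsLevel ev v n d D) (hd : 1 < d) : ∃ Φ, IsKey ev v d D Φ := by
  obtain ⟨T, hT0, hTD, hTv⟩ := h.exists_not_dvd d D hL.mul_eq hd
  have hdeg : T.natDegree = D := by
    refine le_antisymm hTD (not_lt.mp fun hlt => hTv (hL.dvd T hT0 ?_))
    rw [degree_eq_natDegree hT0]
    exact_mod_cast hlt
  have hDn : D < n := by
    rw [← hL.mul_eq]
    have := (h.pos_of_isLevel hL).2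
    nlinarith
  have hlc := inv_ne_zero (leadingCoeff_ne_zero.mpr hT0)
  refine ⟨C T.leadingCoeff⁻¹ * T, monic_C_mul_of_mul_leadingCoeff_eq_one
    (inv_mul_cancel₀ (leadingCoeff_ne_zero.mpr hT0)), by rw [natDegree_C_mul hlc, hdeg],
    fun hdvd => hTv ?_⟩
  have hTev : ev T ≠ 0 := h.ne_zero T hT0 (by
    rw [degree_eq_natDegree hT0, hdeg]
    exact_mod_cast hDn)
  have hC : ev (C T.leadingCoeff⁻¹) ≠ 0 := (map_ne_zero (ev.comp C)).mpr hlc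
  rw [map_mul, h.isDegree.mul _ _ hC hTev] at hdvd
  have hdn : (d : ℤ) ∣ n := by exact_mod_cast Dvd.intro D hL.mul_eq
  exact (dvd_add_right (hdn.trans (h.dvd_C _ hlc))).mp hdvd

theorem hasWeight_of_hasBound_pow (h : IsLine ev v P n)
    (hL : IsLevel ev v n d D) (hΦ : IsKey ev v d D Φ) {e : ℕ}
    (he : ∀ j : ℤ, (d : ℤ) ∣ j * v (ev Φ) → (e : ℤ) ∣ j) (hen : e * D ≤ n) {Ψ : F[X]}
    (hΨ : Ψ.Monic) (hΨe : Ψ.natDegree = e * D) (hb : HasBound v (e * v (ev Φ)) (ev Ψ)) :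
    HasWeight ev v Φ (e * v (ev Φ)) Ψ := by
  have hvΦ : v (ev (Φ ^ e)) = e * v (ev Φ) := by
    rw [map_pow, h.isDegree.pow (h.ev_key_ne_zero hL hΦ)]
  have hlt : (Ψ - Φ ^ e).degree < ((e * D : ℕ) : WithBot ℕ) := by
    rw [← hΨe, ← degree_eq_natDegree hΨ.ne_zero]
    refine degree_sub_lt_left ?_ hΨ.ne_zero
      (hΨ.leadingCoeff.trans (hΦ.monic.pow e).leadingCoeff.symm)
    rw [degree_eq_natDegree hΨ.ne_zero, degree_eq_natDegree (hΦ.monic.pow e).ne_zero,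
      hΦ.monic.natDegree_pow, hΦ.natDegree, hΨe]
  rw [← sub_add_cancel Ψ (Φ ^ e)]
  refine h.hasWeight_add (h.hasWeight_self hL hΦ he hlt ?_ fun h0 =>
    h.ne_zero _ h0 (hlt.trans_le (by exact_mod_cast hen))) ?_
  · rw [map_sub]
    exact h.isDegree.bound_sub hb fun _ => hvΦ.le
  · have := hΦ.hasWeight_mul_pow (a := 1) (k := e * v (ev Φ)) (by
      rw [degree_one]
      exact_mod_cast (h.pos_of_isLevel hL).2) e fun _ => by simp [h.isDegree.one]
    rwa [one_mul] at this

/-- The degree of the value of a key polynomial of the next level is smaller than expected. -/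
theorem v_key_lt (h : IsLine ev v P n)
    (hL : IsLevel ev v n d D) (hΦ : IsKey ev v d D Φ) {d' e : ℕ} {Ψ : F[X]}
    (hL' : IsLevel ev v n d' (e * D)) (hΨ : IsKey ev v d' (e * D) Ψ)
    (hd' : (d' : ℤ) ∣ v (ev Φ)) : v (ev Ψ) < e * v (ev Φ) := by
  have hΦ0 := h.ev_key_ne_zero hL hΦ
  have hvΦ : v (ev (Φ ^ e)) = e * v (ev Φ) := by rw [map_pow, h.isDegree.pow hΦ0]
  by_contra! hle
  have hne : v (ev Ψ) ≠ e * v (ev Φ) := fun h0 => hΨ.not_dvd (h0 ▸ hd'.mul_left _)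
  have hlt : (Ψ - Φ ^ e).degree < ((e * D : ℕ) : WithBot ℕ) := by
    rw [← hΨ.degree]
    refine degree_sub_lt_left ?_ hΨ.monic.ne_zero
      (hΨ.monic.leadingCoeff.trans (hΦ.monic.pow e).leadingCoeff.symm)
    rw [hΨ.degree, degree_eq_natDegree (hΦ.monic.pow e).ne_zero,
      hΦ.monic.natDegree_pow, hΦ.natDegree]
  obtain ⟨h1, h2⟩ := h.isDegree.add_eq_right (x := ev (-Φ ^ e)) (h.ev_key_ne_zero hL' hΨ)
    fun _ => by
      rw [map_neg, h.isDegree.neg, hvΦ]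
      omega
  rw [← map_add, neg_add_eq_sub] at h1 h2
  exact hΨ.not_dvd (h2 ▸ hL'.dvd _ (fun h0 => h1 (by rw [h0, map_zero])) hlt)

theorem degree_map_eq (h : IsLine ev v P n)
    : (P.map (algebraMap A F)).degree = (n : WithBot ℕ) := by
  rw [h.monic.degree_map, ← h.natDegree]
  exact degree_eq_natDegree fun h0 => by
    have := h.natDegree
    rw [h0, natDegree_zero] at this
    exact h.pos.ne this

theorem natDegree_map_eq (h : IsLine ev v P n) : (P.map (algebraMap A F)).natDegree = n :=
  natDegree_eq_of_degree_eq_some h.degree_map_eq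

theorem natDegree_digits_le (h : IsLine ev v P n)
    (hL : IsLevel ev v n d D) (hΦ : IsKey ev v d D Φ) {c : F[X][X]}
    (hc : IsDigits Φ c) (hcP : c.eval Φ = P.map (algebraMap A F)) : c.natDegree ≤ d := by
  have h1 : c.degree < ((d + 1 : ℕ) : WithBot ℕ) := hc.degree_lt hΦ.monic (by
    rw [hcP, h.degree_map_eq, hΦ.natDegree, ← hL.mul_eq, add_mul]
    have := (h.pos_of_isLevel hL).2
    exact_mod_cast (by omega : d * D < d * D + 1 * D))
  by_cases hc0 : c = 0
  · simp [hc0]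
  rw [degree_eq_natDegree hc0] at h1
  have : c.natDegree < d + 1 := by exact_mod_cast h1
  omega

theorem hasWeight_root (h : IsLine ev v P n) (hL : IsLevel ev v n d D) (hΦ : IsKey ev v d D Φ) :
    HasWeight ev v Φ (d * v (ev Φ)) (P.map (algebraMap A F)) := by
  induction d using Nat.strong_induction_on generalizing D Φ with
  | _ d ih =>
    obtain ⟨d', e, hde, he1, hd'0, hd'δ, he⟩ :=
      exists_index_of_not_dvd (h.pos_of_isLevel hL).1 hΦ.not_dvd
    have hL' := h.isLevel_mul hL hΦ hde hd'δ he
    have hen := h.le_of_isLevel hL'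
    rcases Nat.lt_or_ge 1 d' with hd' | hd'
    · obtain ⟨Ψ, hΨ⟩ := h.exists_isKey hL' hd'
      have hlt := h.v_key_lt hL hΦ hL' hΨ hd'δ
      have hwΨ := h.hasWeight_of_hasBound_pow hL hΦ he hen hΨ.monic hΨ.natDegree
        fun _ => hlt.le
      obtain ⟨c, hc, hcP, hcb⟩ := ih d' (by nlinarith) hL' hΨ
      have hcd := h.natDegree_digits_le hL' hΨ hc hcP
      rw [← hcP, eval_eq_sum_range]
      refine h.hasWeight_sum hΦ _ _ fun j hj => ?_
      have hjd : j ≤ d' := (Nat.lt_succ_iff.mp (Finset.mem_range.mp hj)).trans hcd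
      have hcj : (c.coeff j).degree < ((e * D : ℕ) : WithBot ℕ) := hΨ.degree ▸ hc j
      have h1 : HasWeight ev v Φ (d * v (ev Φ) - j * (e * v (ev Φ))) (c.coeff j) := by
        refine h.hasWeight_self hL hΦ he hcj (fun h0 => (hcb j h0).trans ?_) fun h0 =>
          h.ev_ne_zero_of_degree_lt hL' h0 hcj
        rw [hde]
        push_cast
        have : ((d' : ℤ) - j) * v (ev Ψ) ≤ ((d' : ℤ) - j) * (e * v (ev Φ)) :=
          mul_le_mul_of_nonneg_left hlt.le (by omega)
        linarith
      convert h.hasWeight_mul hL hΦ h1 (h.hasWeight_pow hL hΦ hwΨ j) using 1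
      ring
    · obtain rfl : d' = 1 := by omega
      rw [one_mul] at hde
      subst hde
      exact h.hasWeight_of_hasBound_pow hL hΦ he hen (h.monic.map _)
        (h.natDegree_map_eq.trans hL.mul_eq.symm) fun h0 => absurd h.root h0

theorem isKey_add (h : IsLine ev v P n)
    (hL : IsLevel ev v n d D) (hΦ : IsKey ev v d D Φ) {r : F} (hr : (d : F) * r = 1)
    {p : F[X]} (hp : p.degree < (D : WithBot ℕ))
    (hlt : (P.map (algebraMap A F) - Φ ^ d - p * Φ ^ (d - 1)).degree <
      (((d - 1) * D : ℕ) : WithBot ℕ)) : IsKey ev v d D (Φ + C r * p) := by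
  have hd := h.one_lt_of_isKey hL hΦ
  have hDpos := (h.pos_of_isLevel hL).2
  have hrp : (C r * p).degree < Φ.degree := by
    rw [hΦ.degree]
    rw [← smul_eq_C_mul]
    exact (degree_smul_le r p).trans_lt hp
  obtain ⟨c, hc, hcP, hcb⟩ := h.hasWeight_root hL hΦ
  have hcd : c.coeff (d - 1) = p := by
    have hc' : IsDigits Φ (c - X ^ d - C p * X ^ (d - 1)) := fun j => by
      rw [coeff_sub, coeff_sub, coeff_X_pow, coeff_C_mul_X_pow]
      refine (degree_sub_le _ _).trans_lt (max_lt ((degree_sub_le _ _).trans_lt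
        (max_lt (hc j) ?_)) ?_) <;> rw [hΦ.degree] <;> split_ifs
      · rw [degree_one]
        exact_mod_cast hDpos
      · exact degree_zero.trans_lt (WithBot.bot_lt_coe _)
      · exact hp
      · exact degree_zero.trans_lt (WithBot.bot_lt_coe _)
    have h1 := coeff_eq_zero_of_degree_lt (hc'.degree_lt hΦ.monic (N := d - 1) (by
      rw [hΦ.natDegree]
      simpa [hcP] using hlt))
    rw [coeff_sub, coeff_sub, coeff_X_pow, coeff_C_mul_X_pow, if_neg (by omega), if_pos rfl,
      sub_zero] at h1
    exact sub_eq_zero.mp h1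
  have hb := hcb (d - 1)
  rw [hcd] at hb
  have hr0 : r ≠ 0 := right_ne_zero_of_mul (hr ▸ one_ne_zero)
  have hd0 : (d : F) ≠ 0 := left_ne_zero_of_mul (hr ▸ one_ne_zero)
  have hCr : ev (C r) ≠ 0 := (map_ne_zero (ev.comp C)).mpr hr0
  have hvr : v (ev (C r)) = 0 := by
    have hCd : ev (C (d : F)) ≠ 0 := (map_ne_zero (ev.comp C)).mpr hd0
    have h1 := h.isDegree.mul _ _ hCd hCr
    rw [← map_mul, ← C_mul, hr, C_1, map_one, h.isDegree.one, C_eq_natCast, map_natCast,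
      h.natCast d (by omega)] at h1
    omega
  have hv : v (ev (Φ + C r * p)) = v (ev Φ) := by
    rw [add_comm, map_add]
    refine (h.isDegree.add_eq_right (h.ev_key_ne_zero hL hΦ) fun h0 => ?_).2
    rw [map_mul] at h0 ⊢
    have hp0 := right_ne_zero_of_mul h0
    rw [h.isDegree.mul _ _ hCr hp0, hvr, zero_add]
    refine lt_of_le_of_ne ((hb hp0).trans_eq ?_) fun h1 =>
      hΦ.not_dvd (h1 ▸ hL.dvd p (fun h2 => hp0 (by rw [h2, map_zero])) hp)
    push_cast [Nat.cast_sub hd.le]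
    ring
  refine ⟨hΦ.monic.add_of_left hrp, ?_, hv ▸ hΦ.not_dvd⟩
  rw [natDegree_add_eq_left_of_degree_lt hrp, hΦ.natDegree]

/-- The approximate root over `A` of the polynomial `P` is a key polynomial. -/
theorem exists_isKey_map (h : IsLine ev v P n)
    [Nontrivial A] (hL : IsLevel ev v n d D) (hd : 1 < d) :
    ∃ Q : A[X], Q.Monic ∧ IsKey ev v d D (Q.map (algebraMap A F)) := by
  have hd0 : d ≠ 0 := by omega
  have hP : (P.map (algebraMap A F)).natDegree = d * D := h.natDegree_map_eq.trans hL.mul_eq.symm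
  obtain ⟨r, hr⟩ := (h.isUnit d hd0).exists_right_inv
  have hr' : (d : F) * algebraMap A F r = 1 := by
    rw [← map_natCast (algebraMap A F), ← map_mul, hr, map_one]
  obtain ⟨Q, ⟨hQ, hQD⟩, hQP⟩ := exists_approximateRoot h.monic (by omega : 0 < d)
    (h.natDegree.trans hL.mul_eq.symm) hr (fun Φ => Φ.Monic ∧ Φ.natDegree = D) (fun _ h0 => h0)
    (fun Φ p hΦ hp _ => by
      have hrp : (C r * p).degree < Φ.degree := by
        rw [degree_eq_natDegree hΦ.1.ne_zero, hΦ.2]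
        rw [← smul_eq_C_mul]
        exact (degree_smul_le r p).trans_lt hp
      exact ⟨hΦ.1.add_of_left hrp, by rw [natDegree_add_eq_left_of_degree_lt hrp, hΦ.2]⟩)
    ⟨X ^ D, monic_X_pow D, natDegree_X_pow D⟩
  obtain ⟨Φ, hΦ, hΦP⟩ := exists_approximateRoot (h.monic.map (algebraMap A F))
    (by omega : 0 < d) hP hr' (IsKey ev v d D)
    (fun _ h0 => ⟨h0.monic, h0.natDegree⟩)
    (fun _ _ h0 hp hlt => h.isKey_add hL h0 hr' hp hlt) (h.exists_isKey hL hd)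
  refine ⟨Q, hQ, ?_⟩
  rwa [approximateRoot_unique (left_ne_zero_of_mul (hr' ▸ one_ne_zero)) (hQ.map _) hΦ.monic
    ((hQ.natDegree_map _).trans hQD) hΦ.natDegree ?_ hΦP]
  rw [← Polynomial.map_pow, ← Polynomial.map_sub]
  exact degree_map_le.trans_lt hQP

/-- If `Q` has coefficients in `A`, so have the digits of a polynomial with coefficients in `A`. -/
theorem exists_digits_map (h : IsLine ev v P n)
    [Nontrivial A] (hL : IsLevel ev v n d D) {Q : A[X]} (hQ : Q.Monic)
    (hΦ : IsKey ev v d D (Q.map (algebraMap A F))) {e : ℕ}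
    (he : ∀ j : ℤ, (d : ℤ) ∣ j * v (ev (Q.map (algebraMap A F))) → (e : ℤ) ∣ j) {T : A[X]}
    (hT : T.degree < ((e * D : ℕ) : WithBot ℕ)) (hT0 : T.map (algebraMap A F) ≠ 0) :
    ∃ a : A[X], a.degree < D ∧ a.map (algebraMap A F) ≠ 0 ∧ ∃ i < e,
      v (ev (T.map (algebraMap A F))) =
        v (ev (a.map (algebraMap A F))) + i * v (ev (Q.map (algebraMap A F))) := by
  have hQD : Q.natDegree = D := by rw [← hQ.natDegree_map (algebraMap A F), hΦ.natDegree]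
  have hQd : Q.degree = (D : WithBot ℕ) := by rw [degree_eq_natDegree hQ.ne_zero, hQD]
  obtain ⟨c, hc, hcT⟩ := exists_isDigits hQ (hQD.symm ▸ (h.pos_of_isLevel hL).2) T
  have hc' : IsDigits (Q.map (algebraMap A F)) (c.map (mapRingHom (algebraMap A F))) := fun j => by
    rw [coeff_map, coe_mapRingHom, hΦ.degree, ← hQd]
    exact degree_map_le.trans_lt (hc j)
  have hcT' : (c.map (mapRingHom (algebraMap A F))).eval (Q.map (algebraMap A F)) =
      T.map (algebraMap A F) := by
    rw [← hcT, ← coe_mapRingHom, eval_map, eval₂_hom]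
  obtain ⟨i, hi, hi0, hv, -⟩ := h.exists_coeff_eq hL hΦ he hc'
    (by rw [hcT']; exact degree_map_le.trans_lt hT) (by rwa [hcT'])
  rw [coeff_map, coe_mapRingHom] at hi0 hv
  exact ⟨c.coeff i, hQd ▸ hc i, hi0, i, hi, by rw [← hcT', hv]⟩

/-- The degrees of values of polynomials over `A` of degree less than `D` include all
multiples of `d`. -/
theorem exists_v_eq_mul (h : IsLine ev v P n) [Nontrivial A] (hL : IsLevel ev v n d D) (k : ℕ) :
    ∃ T : A[X], T.degree < D ∧ T.map (algebraMap A F) ≠ 0 ∧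
      v (ev (T.map (algebraMap A F))) = k * d := by
  induction d using Nat.strong_induction_on generalizing D k with
  | _ d ih =>
    have hd0 := (h.pos_of_isLevel hL).1
    rcases Nat.lt_or_ge 1 d with hd | hd
    · obtain ⟨Q, hQ, hΦ⟩ := h.exists_isKey_map hL hd
      obtain ⟨d', e, hde, he1, hd'0, hd'δ, he⟩ := exists_index_of_not_dvd hd0 hΦ.not_dvd
      obtain ⟨T, hT, hT0, hTv⟩ := ih d' (by nlinarith) (h.isLevel_mul hL hΦ hde hd'δ he) (k * e)
      obtain ⟨a, ha, ha0, i, hi, hv⟩ := h.exists_digits_map hL hQ hΦ he hT hT0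
      have hda := hL.dvd _ ha0 (degree_map_le.trans_lt ha)
      have hvT : v (ev (T.map (algebraMap A F))) = k * d := by
        rw [hTv, hde]
        push_cast
        ring
      rw [hv] at hvT
      have h1 : (d : ℤ) ∣ i * v (ev (Q.map (algebraMap A F))) :=
        (dvd_add_right hda).mp (hvT ▸ dvd_mul_left _ _)
      have h2 : i = 0 := Nat.eq_zero_of_dvd_of_lt (by exact_mod_cast he _ h1) hi
      refine ⟨a, ha, ha0, ?_⟩
      rw [← hvT, h2]
      simp
    · obtain rfl : d = 1 := by omega
      obtain ⟨T, hT, hT0, hTv⟩ := h.surjective k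
      refine ⟨T, ?_, hT0, by rw [hTv, Nat.cast_one, mul_one]⟩
      have := hL.mul_eq
      rw [one_mul] at this
      rwa [this]

theorem dvd_or_dvd (h : IsLine ev v P n) [Nontrivial A] : (n : ℤ) ∣ v (ev X) ∨ v (ev X) ∣ n := by
  by_contra! hnot
  obtain ⟨hn, hm⟩ := hnot
  have hL : IsLevel ev v n n 1 := ⟨mul_one n, fun T hT hT1 => by
    have h1 : T = C (T.coeff 0) := eq_C_of_degree_le_zero (by
      rw [degree_eq_natDegree hT] at hT1 ⊢
      have : T.natDegree < 1 := by exact_mod_cast hT1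
      exact_mod_cast (by omega : T.natDegree ≤ 0))
    rw [h1] at hT ⊢
    exact h.dvd_C _ fun h0 => hT (by rw [h0, C_0])⟩
  have hX : (X : A[X]).map (algebraMap A F) = X := map_X _
  have hΦ : IsKey ev v n 1 ((X : A[X]).map (algebraMap A F)) := by
    rw [hX]
    exact ⟨monic_X, natDegree_X, hn⟩
  have hm0 : 0 ≤ v (ev X) := by
    have := h.nonneg X (h.ev_key_ne_zero hL hΦ)
    rwa [hX] at this
  obtain ⟨d', e, hde, he1, hd'0, hd'δ, he⟩ := exists_index_of_not_dvd h.pos hΦ.not_dvd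
  obtain ⟨T, hT, hT0, hTv⟩ := h.exists_v_eq_mul (h.isLevel_mul hL hΦ hde hd'δ he) 1
  obtain ⟨a, ha, ha0, i, hi, hv⟩ := h.exists_digits_map hL monic_X hΦ he hT hT0
  have ha1 := (degree_map_le (f := algebraMap A F)).trans_lt ha
  have hna := hL.dvd _ ha0 ha1
  have ha2 := h.nonneg a (h.ev_ne_zero_of_degree_lt hL ha0 ha1)
  rw [hX, hTv, Nat.cast_one, one_mul] at hv
  have hde' : (n : ℤ) = d' * e := by exact_mod_cast hde
  rcases ha2.eq_or_lt with h0 | h0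
  · rw [← h0, zero_add] at hv
    exact hm (hde' ▸ (hv ▸ dvd_mul_left _ _ : v (ev X) ∣ (d' : ℤ)).mul_right _)
  · have h1 := Int.le_of_dvd h0 hna
    have h2 : 0 ≤ (i : ℤ) * v (ev X) := by positivity
    have h3 : (1 : ℤ) < e := by exact_mod_cast he1
    have h4 : (0 : ℤ) < d' := by exact_mod_cast hd'0
    nlinarith

end IsLine

end Key
/-! ### The line associated with two generators of a polynomial ring -/

section Generators

open IntermediateField IntermediateField.algebraAdjoinAdjoin

variable {K : Type*} [Field K]

theorem isDegree_intDegree : IsDegree (RatFunc.intDegree : RatFunc K → ℤ) where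
  mul _ _ hx hy := RatFunc.intDegree_mul hx hy
  add_le _ _ _ hy hxy := RatFunc.intDegree_add_le hy hxy

theorem aeval_algebraMap_ratFunc (f r : K[X]) :
    aeval (algebraMap K[X] (RatFunc K) f) r = algebraMap K[X] (RatFunc K) (r.comp f) := by
  rw [aeval_algebraMap_apply, comp, aeval_def, algebraMap_eq]

theorem natDegree_dvd_intDegree (f : K[X]) {x : RatFunc K}
    (hx : x ∈ K⟮algebraMap K[X] (RatFunc K) f⟯) (hx0 : x ≠ 0) :
    (f.natDegree : ℤ) ∣ x.intDegree := by
  obtain ⟨r, s, rfl⟩ := (mem_adjoin_simple_iff K x).mp hx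
  obtain ⟨hr, hs⟩ := div_ne_zero_iff.mp hx0
  rw [RatFunc.intDegree_div hr hs, aeval_algebraMap_ratFunc, aeval_algebraMap_ratFunc,
    RatFunc.intDegree_polynomial, RatFunc.intDegree_polynomial, natDegree_comp, natDegree_comp]
  push_cast
  exact dvd_sub (dvd_mul_left _ _) (dvd_mul_left _ _)

/-- Combinations of `1, z, …, z ^ (n - 1)` over `K(f)`, where `n = deg f`. -/
theorem intDegree_sum_smul_X_pow (f : K[X])
    (c : Fin f.natDegree → K⟮algebraMap K[X] (RatFunc K) f⟯) :
    (∀ i, c i = 0) ∨ ∃ i, c i ≠ 0 ∧ ∑ j, (c j : RatFunc K) * RatFunc.X ^ (j : ℕ) ≠ 0 ∧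
      (f.natDegree : ℤ) ∣
        (∑ j, (c j : RatFunc K) * RatFunc.X ^ (j : ℕ)).intDegree - (i : ℕ) := by
  have hX (j : ℕ) : (RatFunc.X : RatFunc K) ^ j ≠ 0 := pow_ne_zero j RatFunc.X_ne_zero
  have hdvd (i) (hi : (c i : RatFunc K) * RatFunc.X ^ (i : ℕ) ≠ 0) :
      (f.natDegree : ℤ) ∣ ((c i : RatFunc K) * RatFunc.X ^ (i : ℕ)).intDegree - (i : ℕ) := by
    have hci : (c i : RatFunc K) ≠ 0 := left_ne_zero_of_mul hi
    rw [RatFunc.intDegree_mul hci (hX i),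
      isDegree_intDegree.pow RatFunc.X_ne_zero, RatFunc.intDegree_X, mul_one, add_sub_cancel_right]
    exact natDegree_dvd_intDegree f (c i).2 hci
  rcases isDegree_intDegree.sum_of_pairwise_ne Finset.univ
    (fun i => (c i : RatFunc K) * RatFunc.X ^ (i : ℕ)) (fun i _ j _ hi hj hij => by
      have h1 := dvd_sub (hdvd j hj) (hdvd i hi)
      rw [hij, sub_sub_sub_cancel_left] at h1
      have h2 := Int.eq_zero_of_abs_lt_dvd h1 (by rw [abs_lt]; omega)
      exact Fin.ext (by omega)) with h0 | ⟨i, -, hi, hs, hv, -⟩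
  · exact .inl fun i => by
      simpa using (mul_eq_zero.mp (h0 i (Finset.mem_univ i))).resolve_right (hX i)
  · exact .inr ⟨i, fun h0 => hi (by simp [h0]), hs, hv ▸ hdvd i hi⟩

theorem linearIndependent_X_pow (f : K[X]) :
    LinearIndependent K⟮algebraMap K[X] (RatFunc K) f⟯
      fun i : Fin f.natDegree => (RatFunc.X : RatFunc K) ^ (i : ℕ) := by
  rw [Fintype.linearIndependent_iff]
  intro c hc
  simp_rw [IntermediateField.smul_def, smul_eq_mul] at hc
  rcases intDegree_sum_smul_X_pow f c with h | ⟨-, -, h, -⟩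
  · exact h
  · exact absurd hc h

theorem finrank_adjoin_polynomial (f : K[X]) :
    Module.finrank K⟮algebraMap K[X] (RatFunc K) f⟯ (RatFunc K) = f.natDegree := by
  rw [RatFunc.finrank_eq_max_natDegree, RatFunc.num_algebraMap, RatFunc.denom_algebraMap,
    natDegree_one, Nat.max_zero]

/-- There is a polynomial in `g` over `K(f)` of degree at most `n / d` such that `d` does not divide
the degree of its value, where `n = deg f`. -/
theorem exists_not_dvd_intDegree {f g : K[X]} {d D : ℕ} (hdD : d * D = f.natDegree) (hd : 1 < d)
    (hf : 0 < f.natDegree)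
    (hg : ∀ T : K⟮algebraMap K[X] (RatFunc K) f⟯[X], T ≠ 0 → T.degree < f.natDegree →
      aeval (algebraMap K[X] (RatFunc K) g) T ≠ 0) :
    ∃ T : K⟮algebraMap K[X] (RatFunc K) f⟯[X], T ≠ 0 ∧ T.natDegree ≤ D ∧
      ¬(d : ℤ) ∣ (aeval (algebraMap K[X] (RatFunc K) g) T).intDegree := by
  have : Nonempty (Fin f.natDegree) := ⟨⟨0, hf⟩⟩
  let b := basisOfLinearIndependentOfCardEqFinrank (linearIndependent_X_pow f)
    (by rw [Fintype.card_fin, finrank_adjoin_polynomial])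
  have hb (i) : b i = (RatFunc.X : RatFunc K) ^ (i : ℕ) := by
    simp [b]
  let L : degreeLT K⟮algebraMap K[X] (RatFunc K) f⟯ (D + 1) →ₗ[K⟮algebraMap K[X] (RatFunc K) f⟯]
      (Fin D → K⟮algebraMap K[X] (RatFunc K) f⟯) :=
    LinearMap.funLeft _ _ (fun k : Fin D => (⟨d * k, by
      rw [← hdD]
      exact Nat.mul_lt_mul_of_pos_left k.2 (by omega)⟩ : Fin f.natDegree)) ∘ₗ
      b.equivFun.toLinearMap ∘ₗ (aeval (algebraMap K[X] (RatFunc K) g)).toLinearMap ∘ₗ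
      Submodule.subtype _
  obtain ⟨⟨T, hT⟩, hTL, hT0⟩ := Submodule.exists_mem_ne_zero_of_ne_bot
    (L.ker_ne_bot_of_finrank_lt (by
      rw [(degreeLTEquiv _ (D + 1)).finrank_eq, Module.finrank_fin_fun, Module.finrank_fin_fun]
      exact Nat.lt_succ_self D))
  have hT0 : T ≠ 0 := fun h0 => hT0 (Subtype.ext h0)
  rw [mem_degreeLT, degree_eq_natDegree hT0] at hT
  have hTD : T.natDegree < D + 1 := by exact_mod_cast hT
  refine ⟨T, hT0, by omega, fun hdvd => ?_⟩
  have hTe := hg T hT0 (by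
    rw [degree_eq_natDegree hT0]
    have : T.natDegree < f.natDegree := by nlinarith
    exact_mod_cast this)
  have hsum := b.sum_equivFun (aeval (algebraMap K[X] (RatFunc K) g) T)
  simp_rw [hb, IntermediateField.smul_def, smul_eq_mul] at hsum
  rcases intDegree_sum_smul_X_pow f
    (b.equivFun (aeval (algebraMap K[X] (RatFunc K) g) T)) with h0 | ⟨i, hi, -, hv⟩
  · rw [Finset.sum_eq_zero fun i _ => by simp [h0 i]] at hsum
    exact hTe hsum.symm
  · rw [hsum] at hv
    have hdn : (d : ℤ) ∣ f.natDegree := by exact_mod_cast Dvd.intro D hdD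
    have h1 : (d : ℤ) ∣ (i : ℕ) := (dvd_sub_right hdvd).mp (hdn.trans hv)
    obtain ⟨k, hk⟩ : d ∣ (i : ℕ) := by exact_mod_cast h1
    have hkD : k < D := by
      have := i.2
      rw [hk, ← hdD] at this
      exact Nat.lt_of_mul_lt_mul_left this
    have h2 := congrFun (LinearMap.mem_ker.mp hTL) ⟨k, hkD⟩
    apply hi
    rw [← Fin.ext (a := ⟨d * k, hk ▸ i.2⟩) hk.symm]
    exact h2

section Generate

variable {f g : K[X]}

theorem exists_aeval_eq (hgen : Algebra.adjoin K ({f, g} : Set K[X]) = ⊤) (p : K[X]) :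
    ∃ T : (Algebra.adjoin K {algebraMap K[X] (RatFunc K) f})[X],
      aeval (algebraMap K[X] (RatFunc K) g) T = algebraMap K[X] (RatFunc K) p := by
  have hp : p ∈ Algebra.adjoin K ({f, g} : Set K[X]) := hgen ▸ Algebra.mem_top
  induction hp using Algebra.adjoin_induction with
  | mem x hx =>
    rcases hx with rfl | rfl
    · exact ⟨C ⟨_, Algebra.self_mem_adjoin_singleton K _⟩, aeval_C _ _⟩
    · exact ⟨X, aeval_X _⟩
  | algebraMap r =>
    refine ⟨algebraMap K _ r, ?_⟩
    rw [← IsScalarTower.algebraMap_apply, IsScalarTower.algebraMap_apply K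
      (Algebra.adjoin K {algebraMap K[X] (RatFunc K) f}) _[X], AlgHom.commutes]
    rfl
  | add x y _ _ hx hy =>
    obtain ⟨T, hT⟩ := hx
    obtain ⟨U, hU⟩ := hy
    exact ⟨T + U, by rw [map_add, map_add, hT, hU]⟩
  | mul x y _ _ hx hy =>
    obtain ⟨T, hT⟩ := hx
    obtain ⟨U, hU⟩ := hy
    exact ⟨T * U, by rw [map_mul, map_mul, hT, hU]⟩

theorem exists_algebraMap_eq_aeval (T : (Algebra.adjoin K {algebraMap K[X] (RatFunc K) f})[X]) :
    ∃ p : K[X], algebraMap K[X] (RatFunc K) p = aeval (algebraMap K[X] (RatFunc K) g) T := by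
  have hle : Algebra.adjoin K {algebraMap K[X] (RatFunc K) f} ≤
      (IsScalarTower.toAlgHom K K[X] (RatFunc K)).range :=
    Algebra.adjoin_le (by
      rintro _ rfl
      exact ⟨f, rfl⟩)
  have : aeval (algebraMap K[X] (RatFunc K) g) T ∈
      (IsScalarTower.toAlgHom K K[X] (RatFunc K)).range := by
    rw [aeval_eq_sum_range]
    exact sum_mem fun i _ => mul_mem (hle (T.coeff i).2) (pow_mem (AlgHom.mem_range_self _ g) i)
  obtain ⟨p, hp⟩ := this
  exact ⟨p, hp⟩

theorem adjoin_simple_eq_top (hgen : Algebra.adjoin K ({f, g} : Set K[X]) = ⊤) :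
    IntermediateField.adjoin K⟮algebraMap K[X] (RatFunc K) f⟯
      {algebraMap K[X] (RatFunc K) g} = ⊤ := by
  have hpoly (p : K[X]) : algebraMap K[X] (RatFunc K) p ∈
      IntermediateField.adjoin K⟮algebraMap K[X] (RatFunc K) f⟯
        {algebraMap K[X] (RatFunc K) g} := by
    obtain ⟨T, hT⟩ := exists_aeval_eq hgen p
    rw [← hT, ← aeval_map_algebraMap K⟮algebraMap K[X] (RatFunc K) f⟯]
    exact algebra_adjoin_le_adjoin _ _ (aeval_mem_adjoin_singleton _ _)
  refine eq_top_iff.mpr fun x _ => ?_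
  rw [← RatFunc.num_div_denom x]
  exact div_mem (hpoly _) (hpoly _)

theorem isIntegral_X (hf : 0 < f.natDegree) :
    IsIntegral (Algebra.adjoin K {algebraMap K[X] (RatFunc K) f}) (RatFunc.X : RatFunc K) := by
  have hlc : f.leadingCoeff ≠ 0 := leadingCoeff_ne_zero.mpr fun h0 => by simp [h0] at hf
  have hm : (C f.leadingCoeff⁻¹ * f).Monic :=
    monic_C_mul_of_mul_leadingCoeff_eq_one (inv_mul_cancel₀ hlc)
  let t : Algebra.adjoin K {algebraMap K[X] (RatFunc K) f} :=
    ⟨_, Algebra.self_mem_adjoin_singleton K _⟩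
  refine ⟨(C f.leadingCoeff⁻¹ * f).map (algebraMap K _) - C (algebraMap K _ f.leadingCoeff⁻¹ * t),
    (hm.map _).sub_of_left (degree_C_le.trans_lt ?_), ?_⟩
  · rw [hm.degree_map, degree_C_mul (inv_ne_zero hlc)]
    exact natDegree_pos_iff_degree_pos.mp hf
  · rw [← aeval_def, map_sub, aeval_map_algebraMap, aeval_C, map_mul, map_mul, aeval_C,
      ← IsScalarTower.algebraMap_apply, sub_eq_zero]
    congr 1
    rw [← RatFunc.algebraMap_X, aeval_algebraMap_ratFunc, comp_X]
    rfl

theorem isIntegral_algebraMap (hf : 0 < f.natDegree) :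
    IsIntegral (Algebra.adjoin K {algebraMap K[X] (RatFunc K) f})
      (algebraMap K[X] (RatFunc K) g) := by
  rw [show algebraMap K[X] (RatFunc K) g = aeval (RatFunc.X : RatFunc K) g by
    rw [← RatFunc.algebraMap_X, aeval_algebraMap_ratFunc, comp_X],
    ← aeval_map_algebraMap (Algebra.adjoin K {algebraMap K[X] (RatFunc K) f})]
  exact adjoin_le_integralClosure (isIntegral_X hf) (aeval_mem_adjoin_singleton _ _)

theorem minpoly_adjoin_simple {L : Type*} [Field L] [Algebra K L] {t s : L}
    [IsIntegrallyClosed (Algebra.adjoin K {t})] (hs : IsIntegral (Algebra.adjoin K {t}) s) :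
    minpoly K⟮t⟯ s =
      (minpoly (Algebra.adjoin K {t}) s).map (algebraMap (Algebra.adjoin K {t}) K⟮t⟯) :=
  minpoly.isIntegrallyClosed_eq_field_fractions' K⟮t⟯ hs

theorem isLine_minpoly [CharZero K] (hgen : Algebra.adjoin K ({f, g} : Set K[X]) = ⊤)
    (hf : 0 < f.natDegree) :
    IsLine (aeval (R := K⟮algebraMap K[X] (RatFunc K) f⟯)
        (algebraMap K[X] (RatFunc K) g) :
        K⟮algebraMap K[X] (RatFunc K) f⟯[X] →+* RatFunc K) RatFunc.intDegree
      (minpoly (Algebra.adjoin K {algebraMap K[X] (RatFunc K) f}) (algebraMap K[X] (RatFunc K) g))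
      f.natDegree := by
  have hfC : ¬∃ c, algebraMap K[X] (RatFunc K) f = RatFunc.C c := by
    rintro ⟨c, hc⟩
    have h1 := RatFunc.intDegree_polynomial (p := f)
    rw [hc, RatFunc.intDegree_C] at h1
    omega
  have := (RatFunc.transcendental_of_ne_C _ hfC).uniqueFactorizationMonoid_adjoin
  have hint := isIntegral_algebraMap (g := g) hf
  have hm := minpoly.monic hint
  have hmap := minpoly_adjoin_simple hint
  have hintF : IsIntegral K⟮algebraMap K[X] (RatFunc K) f⟯ (algebraMap K[X] (RatFunc K) g) :=
    hint.tower_top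
  have hdeg : (minpoly K⟮algebraMap K[X] (RatFunc K) f⟯
      (algebraMap K[X] (RatFunc K) g)).natDegree = f.natDegree := by
    rw [← IntermediateField.adjoin.finrank hintF, adjoin_simple_eq_top hgen,
      IntermediateField.finrank_top', finrank_adjoin_polynomial]
  have hne (T : K⟮algebraMap K[X] (RatFunc K) f⟯[X]) (hT : T ≠ 0)
      (hlt : T.degree < f.natDegree) : aeval (algebraMap K[X] (RatFunc K) g) T ≠ 0 := fun h0 => by
    have h1 := minpoly.degree_le_of_ne_zero _ _ hT h0
    rw [degree_eq_natDegree (minpoly.ne_zero hintF), hdeg] at h1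
    exact absurd hlt (not_lt.mpr h1)
  have hnat (d : ℕ) : (d : RatFunc K) = RatFunc.C (d : K) := (map_natCast RatFunc.C d).symm
  refine ⟨hf, isDegree_intDegree, fun d _ => ?_, fun d hd => ?_, hm, ?_, ?_, hne, fun c hc => ?_,
    fun d D hdD hd => exists_not_dvd_intDegree hdD hd hf hne, fun T _ => ?_, fun k => ?_⟩
  · rw [hnat, RatFunc.intDegree_C]
  · rw [← map_natCast (algebraMap K _)]
    exact (Nat.cast_ne_zero.mpr hd).isUnit.map _
  · rw [← hdeg, hmap, hm.natDegree_map]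
  · rw [RingHom.coe_coe, aeval_map_algebraMap]
    exact minpoly.aeval _ _
  · rw [RingHom.coe_coe, aeval_C]
    exact natDegree_dvd_intDegree f c.2 (by simpa using hc)
  · rw [RingHom.coe_coe, aeval_map_algebraMap]
    obtain ⟨p, hp⟩ := exists_algebraMap_eq_aeval (g := g) T
    rw [← hp, RatFunc.intDegree_polynomial]
    exact Int.natCast_nonneg _
  · obtain ⟨T, hT⟩ := exists_aeval_eq hgen (X ^ k)
    have hval : aeval (algebraMap K[X] (RatFunc K) g) (T %ₘ minpoly
        (Algebra.adjoin K {algebraMap K[X] (RatFunc K) f}) (algebraMap K[X] (RatFunc K) g)) =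
        algebraMap K[X] (RatFunc K) (X ^ k) := by
      rw [aeval_modByMonic_eq_self_of_root (minpoly.aeval _ _), hT]
    rw [← aeval_map_algebraMap K⟮algebraMap K[X] (RatFunc K) f⟯] at hval
    refine ⟨_, (degree_modByMonic_lt T hm).trans_eq ?_, fun h0 => ?_, ?_⟩
    · rw [degree_eq_natDegree hm.ne_zero, ← hdeg, hmap, hm.natDegree_map]
    · rw [h0, map_zero] at hval
      exact pow_ne_zero k X_ne_zero ((map_eq_zero_iff _ (RatFunc.algebraMap_injective K)).mp
        hval.symm)
    · rw [RingHom.coe_coe, hval, RatFunc.intDegree_polynomial, natDegree_X_pow]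

end Generate

end Generators

end AbhyankarMohSuzuki

/-- Abhyankar–Moh–Suzuki theorem (characteristic zero): if `K[f, g] = K[z]`, then
`deg f ∣ deg g` or `deg g ∣ deg f`. -/
theorem stmt13 (K : Type*) [Field K] [CharZero K] (f g : K[X])
    (hgen : Algebra.adjoin K ({f, g} : Set K[X]) = ⊤) :
    f.natDegree ∣ g.natDegree ∨ g.natDegree ∣ f.natDegree := by
  rcases Nat.eq_zero_or_pos f.natDegree with hf | hf
  · exact .inr (hf ▸ dvd_zero _)
  have h := (AbhyankarMohSuzuki.isLine_minpoly hgen hf).dvd_or_dvd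
  rw [RingHom.coe_coe, aeval_X, RatFunc.intDegree_polynomial] at h
  exact_mod_cast h
end

section
/- Let K be a field of characteristic zero and f, g ∈ K[z] nonconstant. If the subalgebra K[f,g] contains a polynomial of degree d_0 = gcd(deg f, deg g), then d_0 = deg f or d_0 = deg g (Richman's theorem). -/
open Polynomial

open scoped WithZero

/-- Expansion of a polynomial in powers of a monic polynomial `φ`. -/
theorem Polynomial.exists_sum_mul_pow_of_monic {R : Type*} [CommRing R] [Nontrivial R]
    {φ : R[X]} (hφ : φ.Monic) (n : ℕ) (p : R[X])
    (hp : p.degree < (n * φ.natDegree : ℕ)) :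
    ∃ a : ℕ → R[X], (∀ j, (a j).degree < φ.natDegree) ∧
      p = ∑ j ∈ Finset.range n, a j * φ ^ j := by
  induction n generalizing p with
  | zero =>
    refine ⟨fun _ => 0, fun j => by simp, ?_⟩
    simpa [Nat.WithBot.lt_zero_iff] using hp
  | succ n ih =>
    have hq : (p /ₘ φ).degree < (n * φ.natDegree : ℕ) := by
      rw [Polynomial.degree_lt_iff_coeff_zero]
      intro i hi
      by_cases h0 : p /ₘ φ = 0
      · simp [h0]
      apply coeff_eq_zero_of_natDegree_lt
      have h1 : φ.natDegree ≤ p.natDegree := by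
        by_contra hlt
        exact h0 ((divByMonic_eq_zero_iff hφ).2 (degree_lt_degree (not_le.1 hlt)))
      have hp0 : p ≠ 0 := by rintro rfl; simp at h0
      rw [natDegree_divByMonic _ hφ]
      have := (natDegree_lt_iff_degree_lt hp0).2 hp
      rw [add_mul] at this
      omega
    obtain ⟨a, ha, hs⟩ := ih _ hq
    refine ⟨fun j => if j = 0 then p %ₘ φ else a (j - 1), ?_, ?_⟩
    · intro j
      dsimp only
      split_ifs
      · rw [← degree_eq_natDegree hφ.ne_zero]
        exact degree_modByMonic_lt _ hφ
      · exact ha _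
    · rw [Finset.sum_range_succ']
      conv_lhs => rw [← modByMonic_add_div p φ, hs]
      simp [Finset.mul_sum, add_comm, pow_succ]
      refine Finset.sum_congr rfl fun i _ => by ring

/-- The binomial expansion to first order, with a degree bound on the remainder. -/
theorem Polynomial.degree_add_pow_sub_sub_lt {R : Type*} [CommRing R] {φ b : R[X]} {β : ℕ}
    (hφ : φ.Monic) (hb : b.degree ≤ β) (hβ : β < φ.natDegree) (k : ℕ) :
    ((φ + b) ^ (k + 1) - φ ^ (k + 1) - (k + 1) * b * φ ^ k).degree <
      (β + k * φ.natDegree : ℕ) := by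
  nontriviality R
  induction k with
  | zero => simp [bot_lt_iff_ne_bot]
  | succ k ih =>
    have e : (φ + b) ^ (k + 1 + 1) - φ ^ (k + 1 + 1) - ((k + 1 : ℕ) + 1) * b * φ ^ (k + 1) =
        (φ + b) * ((φ + b) ^ (k + 1) - φ ^ (k + 1) - (k + 1) * b * φ ^ k) +
          C ((k : R) + 1) * (b ^ 2 * φ ^ k) := by
      simp only [map_add, map_natCast, map_one]
      push_cast
      ring
    rw [e]
    have hφd : φ.degree = φ.natDegree := degree_eq_natDegree hφ.ne_zero
    have hsum : (φ + b).degree ≤ φ.natDegree :=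
      (degree_add_le _ _).trans (max_le hφd.le (hb.trans (by exact_mod_cast hβ.le)))
    refine (degree_add_le _ _).trans_lt (max_lt ?_ ?_)
    · rw [degree_lt_iff_coeff_zero]
      intro i hi
      by_cases h0 : (φ + b) ^ (k + 1) - φ ^ (k + 1) - (k + 1) * b * φ ^ k = 0
      · simp [h0]
      apply coeff_eq_zero_of_natDegree_lt
      have h1 := (natDegree_lt_iff_degree_lt h0).2 ih
      have h2 := natDegree_le_iff_degree_le.2 hsum
      refine natDegree_mul_le.trans_lt ?_
      rw [add_mul] at hi
      omega
    · have h1 : (C ((k : R) + 1) * (b ^ 2 * φ ^ k)).natDegree ≤ 2 * β + k * φ.natDegree := by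
        refine (natDegree_C_mul_le _ _).trans (natDegree_mul_le.trans (add_le_add ?_ ?_))
        · exact natDegree_pow_le_of_le 2 (natDegree_le_iff_degree_le.2 hb)
        · exact natDegree_pow_le
      refine (natDegree_le_iff_degree_le.1 h1).trans_lt ?_
      rw [add_mul]
      exact_mod_cast (by omega : 2 * β + k * φ.natDegree < β + (k * φ.natDegree + 1 * φ.natDegree))

/-- One Tschirnhausen correction step brings the power of `φ` closer to `Φ`. -/
theorem Polynomial.degree_sub_add_pow_lt {R : Type*} [CommRing R] {Φ φ a : R[X]} {u : R} {k : ℕ}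
    (hφ : φ.Monic) (hu : ((k : R) + 1) * u = 1) (ha : a.degree < φ.natDegree) (ha0 : a ≠ 0)
    (h : (Φ - φ ^ (k + 1) - a * φ ^ k).degree < (k * φ.natDegree : ℕ)) :
    (Φ - (φ + C u * a) ^ (k + 1)).degree < (Φ - φ ^ (k + 1)).degree := by
  have := Nontrivial.of_polynomial_ne ha0
  have haφ : (a * φ ^ k).degree = (a.natDegree + k * φ.natDegree : ℕ) := by
    rw [mul_comm, degree_eq_natDegree, (hφ.pow k).natDegree_mul' ha0, hφ.natDegree_pow, add_comm]
    rwa [Ne, (hφ.pow k).mul_right_eq_zero_iff]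
  have h' : (Φ - φ ^ (k + 1) - a * φ ^ k).degree < (a.natDegree + k * φ.natDegree : ℕ) :=
    h.trans_le (by exact_mod_cast Nat.le_add_left _ _)
  have hΦ : (Φ - φ ^ (k + 1)).degree = (a.natDegree + k * φ.natDegree : ℕ) := by
    rw [← haφ, ← sub_add_cancel (Φ - φ ^ (k + 1)) (a * φ ^ k)]
    exact degree_add_eq_right_of_degree_lt (by rwa [haφ])
  have hua : (C u * a).degree ≤ a.natDegree :=
    (natDegree_le_iff_degree_le.1 (natDegree_C_mul_le u a))
  have hq := degree_add_pow_sub_sub_lt hφ hua ((natDegree_lt_iff_degree_lt ha0).2 ha) k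
  have hu' : ((k : R[X]) + 1) * C u = 1 := by
    simpa only [map_mul, map_add, map_natCast, map_one] using congrArg C hu
  have e : Φ - (φ + C u * a) ^ (k + 1) = (Φ - φ ^ (k + 1) - a * φ ^ k) -
      ((φ + C u * a) ^ (k + 1) - φ ^ (k + 1) - (k + 1) * (C u * a) * φ ^ k) := by
    linear_combination (- a * φ ^ k) * hu'
  rw [e, hΦ]
  exact (degree_sub_le _ _).trans_lt (max_lt h' hq)

/-- Tschirnhausen-type descent to an approximate root of a monic polynomial `Φ`, through monic
polynomials satisfying a predicate `P` that is stable under the correction steps. -/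
theorem Polynomial.exists_approximateRoot {R : Type*} [CommRing R] [Nontrivial R] {Φ : R[X]}
    {u : R} {k N : ℕ}
    (hN : 0 < N) (hu : ((k : R) + 1) * u = 1) (hΦ : Φ.Monic) (hΦN : Φ.natDegree = (k + 1) * N)
    (P : R[X] → Prop)
    (hP : ∀ φ a : R[X], φ.Monic → φ.natDegree = N → P φ → a.degree < N → a ≠ 0 →
      (Φ - φ ^ (k + 1) - a * φ ^ k).degree < (k * N : ℕ) → P (φ + C u * a))
    (φ : R[X]) (hφ : φ.Monic) (hφN : φ.natDegree = N) (hφP : P φ) :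
    ∃ ψ : R[X], ψ.Monic ∧ ψ.natDegree = N ∧ P ψ ∧ (Φ - ψ ^ (k + 1)).degree < (k * N : ℕ) := by
  induction hd : (Φ - φ ^ (k + 1)).degree using WellFoundedLT.induction generalizing φ with
  | ind d ih =>
    subst hφN
    have hlt : (Φ - φ ^ (k + 1)).degree < ((k + 1) * φ.natDegree : ℕ) := by
      have h1 : Φ.degree = ((k + 1) * φ.natDegree : ℕ) := by
        rw [degree_eq_natDegree hΦ.ne_zero, hΦN]
      rw [← h1]
      refine degree_sub_lt_left ?_ hΦ.ne_zero ?_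
      · rw [h1, degree_eq_natDegree (hφ.pow _).ne_zero, hφ.natDegree_pow]
      · rw [hΦ.leadingCoeff, (hφ.pow _).leadingCoeff]
    obtain ⟨a, ha, hs⟩ := exists_sum_mul_pow_of_monic hφ (k + 1) _ hlt
    rw [Finset.sum_range_succ] at hs
    have hlow : (Φ - φ ^ (k + 1) - a k * φ ^ k).degree < (k * φ.natDegree : ℕ) := by
      rw [hs, add_sub_cancel_right]
      refine (degree_sum_le _ _).trans_lt ((Finset.sup_lt_iff (WithBot.bot_lt_coe _)).2 ?_)
      intro j hj
      by_cases h0 : a j = 0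
      · rw [h0, zero_mul, degree_zero]
        exact WithBot.bot_lt_coe _
      have h1 : (a j * φ ^ j).natDegree < k * φ.natDegree := by
        rw [mul_comm, (hφ.pow j).natDegree_mul' h0, hφ.natDegree_pow]
        have h2 := (natDegree_lt_iff_degree_lt h0).2 (ha j)
        have h3 : (j + 1) * φ.natDegree ≤ k * φ.natDegree :=
          Nat.mul_le_mul_right _ (Finset.mem_range.1 hj)
        rw [add_mul] at h3
        omega
      exact degree_le_natDegree.trans_lt (by exact_mod_cast h1)
    by_cases h0 : a k = 0
    · exact ⟨φ, hφ, rfl, hφP, by simpa [h0] using hlow⟩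
    have hC : (C u * a k).degree < φ.degree := by
      rw [degree_eq_natDegree hφ.ne_zero]
      refine (natDegree_le_iff_degree_le.1 (natDegree_C_mul_le u (a k))).trans_lt ?_
      rw [← degree_eq_natDegree h0]
      exact ha k
    exact ih _ (hd ▸ degree_sub_add_pow_lt hφ hu (ha k) h0 hlow) (φ + C u * a k)
      (hφ.add_of_left hC) (natDegree_add_eq_left_of_degree_lt hC)
      (hP φ (a k) hφ rfl hφP (ha k) h0 hlow) rfl

/-- Approximate roots are unique. -/
theorem Polynomial.eq_of_degree_pow_sub_pow_lt {L : Type*} [Field L] [CharZero L] {φ ψ : L[X]}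
    {k : ℕ} (hφ : φ.Monic) (hψ : ψ.Monic) (hd : ψ.natDegree = φ.natDegree)
    (h : (ψ ^ (k + 1) - φ ^ (k + 1)).degree < (k * φ.natDegree : ℕ)) : ψ = φ := by
  by_contra hne
  set b := ψ - φ with hb
  have hb0 : b ≠ 0 := sub_ne_zero.2 hne
  have hbd : b.natDegree < φ.natDegree := by
    refine (natDegree_lt_iff_degree_lt hb0).2 ?_
    rw [← hd, ← degree_eq_natDegree hψ.ne_zero]
    refine degree_sub_lt_left ?_ hψ.ne_zero (by rw [hφ, hψ])
    rw [degree_eq_natDegree hψ.ne_zero, degree_eq_natDegree hφ.ne_zero, hd]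
  have hq := degree_add_pow_sub_sub_lt hφ (degree_le_natDegree (p := b)) hbd k
  have hk : ((k : L) + 1) ≠ 0 := by exact_mod_cast k.succ_ne_zero
  have hlead : (((k : L[X]) + 1) * b * φ ^ k).degree = (b.natDegree + k * φ.natDegree : ℕ) := by
    have : ((k : L[X]) + 1) = C ((k : L) + 1) := by simp
    rw [this, mul_assoc, degree_C_mul hk, degree_mul, degree_pow, degree_eq_natDegree hb0,
      degree_eq_natDegree hφ.ne_zero]
    simp
  have e : ψ ^ (k + 1) - φ ^ (k + 1) =
      ((φ + b) ^ (k + 1) - φ ^ (k + 1) - (k + 1) * b * φ ^ k) + (k + 1) * b * φ ^ k := by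
    simp [hb]
  rw [e, degree_add_eq_right_of_degree_lt (by rwa [hlead]), hlead] at h
  exact absurd h (not_lt.2 (by exact_mod_cast Nat.le_add_left _ _))

/-- A finite sum of elements whose nonzero terms have distinct valuations has the valuation of
its dominating term. -/
theorem Valuation.exists_map_sum_eq {F Γ₀ ι : Type*} [Field F] [LinearOrderedCommGroupWithZero Γ₀]
    (w : Valuation F Γ₀) (s : Finset ι) (a : ι → F)
    (hinj : ∀ i ∈ s, ∀ j ∈ s, a i ≠ 0 → a j ≠ 0 → w (a i) = w (a j) → i = j)
    (h0 : ∃ i ∈ s, a i ≠ 0) :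
    ∃ j ∈ s, a j ≠ 0 ∧ w (∑ i ∈ s, a i) = w (a j) ∧ ∀ i ∈ s, w (a i) ≤ w (a j) := by
  classical
  obtain ⟨i₀, hi₀, hai₀⟩ := h0
  obtain ⟨j, hj, hmax⟩ := s.exists_max_image (fun i => w (a i)) ⟨i₀, hi₀⟩
  have hpos : w (a j) ≠ 0 := fun h =>
    hai₀ ((w.zero_iff).1 (le_zero_iff.1 ((hmax i₀ hi₀).trans h.le)))
  have haj : a j ≠ 0 := (w.ne_zero_iff).1 hpos
  refine ⟨j, hj, haj, ?_, hmax⟩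
  rw [← Finset.add_sum_erase s a hj]
  refine w.map_add_eq_of_lt_left (w.map_sum_lt hpos fun i hi => ?_)
  obtain ⟨hij, hi⟩ := Finset.mem_erase.1 hi
  refine lt_of_le_of_ne (hmax i hi) fun heq => hij ?_
  exact hinj i hi j hj ((w.ne_zero_iff).1 (heq ▸ hpos)) haj heq

section Level

variable {L F : Type*} [Field L] [Field F] [Algebra L F]

theorem Valuation.log_map_mul_pow (w : Valuation F ℤᵐ⁰) {x y : F} (hx : x ≠ 0) (hy : y ≠ 0)
    (j : ℕ) : (w (x * y ^ j)).log = (w x).log + j * (w y).log := by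
  rw [map_mul, WithZero.log_mul (w.ne_zero_iff.2 hx) (w.ne_zero_iff.2 (pow_ne_zero _ hy)), map_pow,
    WithZero.log_pow, nsmul_eq_mul]

/-- `IsLevel w g N e`: nonzero polynomials in `g` of degree less than `N` do not vanish and have
valuations divisible by `e`. -/
def IsLevel (w : Valuation F ℤᵐ⁰) (g : F) (N e : ℕ) (L : Type*) [Field L] [Algebra L F] : Prop :=
  ∀ a : L[X], a ≠ 0 → a.degree < N → aeval g a ≠ 0 ∧ (e : ℤ) ∣ (w (aeval g a)).log

variable {w : Valuation F ℤᵐ⁰} {g : F} {N e e' n : ℕ} {φ : L[X]}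

/-- In an expansion of length `n` in powers of `φ`, one term dominates. -/
theorem IsLevel.exists_dominant (hG : IsLevel w g N e L) (hφ0 : aeval g φ ≠ 0)
    (hn : ∀ i : ℤ, (e : ℤ) ∣ i * (w (aeval g φ)).log → (n : ℤ) ∣ i)
    {a : ℕ → L[X]} (ha : ∀ j, (a j).degree < N) (h0 : ∃ j < n, a j ≠ 0) :
    ∃ j < n, a j ≠ 0 ∧
      w (aeval g (∑ i ∈ Finset.range n, a i * φ ^ i)) = w (aeval g (a j) * aeval g φ ^ j) ∧
      ∀ i < n, w (aeval g (a i) * aeval g φ ^ i) ≤ w (aeval g (a j) * aeval g φ ^ j) := by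
  have hne : ∀ i, aeval g (a i) * aeval g φ ^ i ≠ 0 → a i ≠ 0 := by
    rintro i h hi
    simp [hi] at h
  have hinj : ∀ i ∈ Finset.range n, ∀ j ∈ Finset.range n, aeval g (a i) * aeval g φ ^ i ≠ 0 →
      aeval g (a j) * aeval g φ ^ j ≠ 0 →
      w (aeval g (a i) * aeval g φ ^ i) = w (aeval g (a j) * aeval g φ ^ j) → i = j := by
    intro i hi j hj hi0 hj0 hij
    have hi' := hG _ (hne i hi0) (ha i)
    have hj' := hG _ (hne j hj0) (ha j)
    have hlog := congrArg WithZero.log hij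
    rw [w.log_map_mul_pow hi'.1 hφ0, w.log_map_mul_pow hj'.1 hφ0] at hlog
    have hdvd : (n : ℤ) ∣ (i : ℤ) - j := by
      apply hn
      have := dvd_sub hj'.2 hi'.2
      rwa [show ((i : ℤ) - j) * (w (aeval g φ)).log =
        (w (aeval g (a j))).log - (w (aeval g (a i))).log by linarith]
    have := Int.eq_zero_of_abs_lt_dvd hdvd (by
      have := Finset.mem_range.1 hi
      have := Finset.mem_range.1 hj
      rw [abs_lt]
      omega)
    omega
  obtain ⟨j₀, hj₀, haj₀⟩ := h0
  obtain ⟨j, hj, hj0, hs, hmax⟩ := w.exists_map_sum_eq (Finset.range n)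
    (fun i => aeval g (a i) * aeval g φ ^ i) hinj ⟨j₀, Finset.mem_range.2 hj₀,
      mul_ne_zero (hG _ haj₀ (ha _)).1 (pow_ne_zero _ hφ0)⟩
  refine ⟨j, Finset.mem_range.1 hj, hne j hj0, ?_, fun i hi => hmax i (Finset.mem_range.2 hi)⟩
  simpa using hs

theorem IsLevel.mul (hG : IsLevel w g N e L) (hφ : φ.Monic) (hφN : φ.natDegree = N)
    (hφ0 : aeval g φ ≠ 0) (hn : ∀ i : ℤ, (e : ℤ) ∣ i * (w (aeval g φ)).log → (n : ℤ) ∣ i)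
    (he' : (e' : ℤ) ∣ e) (hδ : (e' : ℤ) ∣ (w (aeval g φ)).log) : IsLevel w g (n * N) e' L := by
  intro p hp hpd
  subst hφN
  obtain ⟨a, ha, hs⟩ := exists_sum_mul_pow_of_monic hφ n p hpd
  have h0 : ∃ j < n, a j ≠ 0 := by
    by_contra! h
    exact hp (hs.trans (Finset.sum_eq_zero fun j hj => by simp [h j (Finset.mem_range.1 hj)]))
  obtain ⟨j, -, haj, hw, -⟩ := hG.exists_dominant hφ0 hn ha h0
  have hj := hG _ haj (ha j)
  rw [← hs] at hw
  constructor
  · rw [← w.ne_zero_iff, hw, w.ne_zero_iff]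
    exact mul_ne_zero hj.1 (pow_ne_zero _ hφ0)
  · rw [hw, w.log_map_mul_pow hj.1 hφ0]
    exact dvd_add (he'.trans hj.2) (hδ.mul_left _)

/-- Correcting `φ` by the subleading coefficient of the `φ`-adic expansion of `Φ` does not change
the valuation of `φ`. -/
theorem IsLevel.map_correction_lt {k : ℕ} (hG : IsLevel w g N e L) (hφ : φ.Monic)
    (hφN : φ.natDegree = N) (hφ0 : aeval g φ ≠ 0) (hφe : ¬ (e : ℤ) ∣ (w (aeval g φ)).log)
    (hn : ∀ i : ℤ, (e : ℤ) ∣ i * (w (aeval g φ)).log → ((k + 1 : ℕ) : ℤ) ∣ i)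
    (he' : (e' : ℤ) ∣ e) (hδ : (e' : ℤ) ∣ (w (aeval g φ)).log) {Φ a : L[X]}
    (hΦ : aeval g Φ = 0 ∨ ¬ (e' : ℤ) ∣ (w (aeval g Φ)).log) (ha : a.degree < N) (ha0 : a ≠ 0)
    (h : (Φ - φ ^ (k + 1) - a * φ ^ k).degree < (k * N : ℕ)) :
    w (aeval g a) < w (aeval g φ) := by
  subst hφN
  obtain ⟨b, hb, hs⟩ := exists_sum_mul_pow_of_monic hφ k _ h
  set c : ℕ → L[X] := fun j => if j = k then a else b j with hc
  have hcd : ∀ j, (c j).degree < φ.natDegree := by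
    intro j
    simp only [hc]
    split_ifs
    exacts [ha, hb j]
  have hck : c k = a := by simp [hc]
  have hsum : Φ = φ ^ (k + 1) + ∑ j ∈ Finset.range (k + 1), c j * φ ^ j := by
    have : ∑ j ∈ Finset.range k, c j * φ ^ j = ∑ j ∈ Finset.range k, b j * φ ^ j := by
      refine Finset.sum_congr rfl fun j hj => ?_
      simp [hc, (Finset.mem_range.1 hj).ne]
    rw [Finset.sum_range_succ, this, ← hs, hck]
    ring
  obtain ⟨j, -, hcj, hw, hmax⟩ := hG.exists_dominant hφ0 hn hcd ⟨k, k.lt_succ_self, by rwa [hck]⟩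
  have hk := hmax k k.lt_succ_self
  rw [hck] at hk
  have hj := hG _ hcj (hcd j)
  have hle : w (aeval g (c j) * aeval g φ ^ j) ≤ w (aeval g φ ^ (k + 1)) := by
    by_contra! hlt
    have hwΦ : w (aeval g Φ) = w (aeval g (c j) * aeval g φ ^ j) := by
      rw [hsum, map_add, map_pow, w.map_add_eq_of_lt_right (by rwa [hw]), hw]
    rcases hΦ with h0 | h0
    · rw [h0, map_zero] at hwΦ
      exact mul_ne_zero hj.1 (pow_ne_zero _ hφ0) (w.zero_iff.1 hwΦ.symm)
    · apply h0
      rw [hwΦ, w.log_map_mul_pow hj.1 hφ0]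
      exact dvd_add (he'.trans hj.2) (hδ.mul_left _)
  have hle' := hk.trans hle
  rw [pow_succ', map_mul, map_mul] at hle'
  have hpos : 0 < w (aeval g φ ^ k) := zero_lt_iff.2 (w.ne_zero_iff.2 (pow_ne_zero _ hφ0))
  refine lt_of_le_of_ne (le_of_mul_le_mul_right hle' hpos) fun heq => hφe ?_
  rw [← heq]
  exact (hG _ ha0 ha).2

variable {R : Type*} [CommRing R] [Algebra R L] [FaithfulSMul R L]

/-- An approximate root over `L` of a polynomial over `R` has coefficients in `R`; it serves as a
key polynomial with the same valuation as `φ`. -/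
theorem IsLevel.exists_key_over_subring [CharZero L] {k : ℕ} (hG : IsLevel w g N e L)
    (hN : 0 < N) (hR : ∃ u : R, ((k : R) + 1) * u = 1) (hw1 : w ((k : F) + 1) = 1)
    (hφ : φ.Monic) (hφN : φ.natDegree = N) (hφ0 : aeval g φ ≠ 0)
    (hφe : ¬ (e : ℤ) ∣ (w (aeval g φ)).log)
    (hn : ∀ i : ℤ, (e : ℤ) ∣ i * (w (aeval g φ)).log → ((k + 1 : ℕ) : ℤ) ∣ i)
    (he' : (e' : ℤ) ∣ e) (hδ : (e' : ℤ) ∣ (w (aeval g φ)).log) {Φ : R[X]} (hΦm : Φ.Monic)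
    (hΦN : Φ.natDegree = (k + 1) * N)
    (hΦ : aeval g (Φ.map (algebraMap R L)) = 0 ∨
      ¬ (e' : ℤ) ∣ (w (aeval g (Φ.map (algebraMap R L)))).log) :
    ∃ ψ : R[X], ψ.Monic ∧ ψ.natDegree = N ∧
      w (aeval g (ψ.map (algebraMap R L))) = w (aeval g φ) := by
  have hinj := FaithfulSMul.algebraMap_injective R L
  have : Nontrivial R := (algebraMap R L).domain_nontrivial
  obtain ⟨u, hu⟩ := hR
  have huL : ((k : L) + 1) * algebraMap R L u = 1 := by
    simpa using congrArg (algebraMap R L) hu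
  have hwu : w (algebraMap L F (algebraMap R L u)) = 1 := by
    have := congrArg (fun x => w (algebraMap L F x)) huL
    simpa [hw1] using this
  obtain ⟨φ₁, h1m, h1N, h1w, h1⟩ := exists_approximateRoot (Φ := Φ.map (algebraMap R L)) hN huL
    (hΦm.map _) ((hΦm.natDegree_map _).trans hΦN) (fun χ => w (aeval g χ) = w (aeval g φ))
    (fun χ a hχ hχN hχw ha ha0 hlt => by
      rw [← hχw] at hφe hn hδ
      have hχ0 : aeval g χ ≠ 0 := by rwa [← w.ne_zero_iff, hχw, w.ne_zero_iff]
      have := hG.map_correction_lt hχ hχN hχ0 hφe hn he' hδ hΦ ha ha0 hlt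
      rw [← hχw, map_add, map_mul, aeval_C]
      exact w.map_add_eq_of_lt_left (by rwa [map_mul, hwu, one_mul]))
    φ hφ hφN rfl
  obtain ⟨ψ, hψm, hψN, -, hψ⟩ := exists_approximateRoot hN hu hΦm hΦN (fun _ => True)
    (fun _ _ _ _ _ _ _ _ => trivial) (X ^ N) (monic_X_pow N) (natDegree_X_pow N) trivial
  refine ⟨ψ, hψm, hψN, ?_⟩
  rw [eq_of_degree_pow_sub_pow_lt (k := k) h1m (hψm.map (algebraMap R L))
    ((hψm.natDegree_map _).trans (hψN.trans h1N.symm)), h1w]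
  have h2 : ((Φ - ψ ^ (k + 1)).map (algebraMap R L)).degree < (k * N : ℕ) := by
    rwa [degree_map_eq_of_injective hinj]
  rw [Polynomial.map_sub, Polynomial.map_pow] at h2
  rw [h1N, ← sub_sub_sub_cancel_left _ _ (Φ.map (algebraMap R L))]
  exact (degree_sub_le _ _).trans_lt (max_lt h1 h2)

/-- Reduction modulo a key polynomial preserves valuations divisible by `e`. -/
theorem IsLevel.exists_reduction (hG : IsLevel w g N e L) {ψ p : R[X]} (hψ : ψ.Monic)
    (hψN : ψ.natDegree = N) (hψ0 : aeval g (ψ.map (algebraMap R L)) ≠ 0)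
    (hn : ∀ i : ℤ, (e : ℤ) ∣ i * (w (aeval g (ψ.map (algebraMap R L)))).log → (n : ℤ) ∣ i)
    (hp : p.degree < (n * N : ℕ)) (hp0 : aeval g (p.map (algebraMap R L)) ≠ 0)
    (hpe : (e : ℤ) ∣ (w (aeval g (p.map (algebraMap R L)))).log) :
    ∃ q : R[X], q.degree < N ∧
      w (aeval g (q.map (algebraMap R L))) = w (aeval g (p.map (algebraMap R L))) := by
  have hinj := FaithfulSMul.algebraMap_injective R L
  have : Nontrivial R := (algebraMap R L).domain_nontrivial
  subst hψN
  obtain ⟨a, ha, hs⟩ := exists_sum_mul_pow_of_monic hψ n p hp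
  have hmap : p.map (algebraMap R L) = ∑ j ∈ Finset.range n,
      (a j).map (algebraMap R L) * ψ.map (algebraMap R L) ^ j := by
    conv_lhs => rw [hs]
    simp [Polynomial.map_sum]
  have h0 : ∃ j < n, (a j).map (algebraMap R L) ≠ 0 := by
    by_contra! h
    apply hp0
    rw [hmap, Finset.sum_eq_zero fun j hj => by rw [h j (Finset.mem_range.1 hj), zero_mul],
      map_zero]
  have ha' : ∀ j, ((a j).map (algebraMap R L)).degree < ψ.natDegree := fun j => by
    rw [degree_map_eq_of_injective hinj]; exact ha j
  obtain ⟨j, hjn, haj, hw, -⟩ := hG.exists_dominant hψ0 hn ha' h0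
  have hj := hG _ haj (ha' j)
  rw [← hmap] at hw
  rw [hw, w.log_map_mul_pow hj.1 hψ0] at hpe
  have hj0 : j = 0 := by
    have := Int.natCast_dvd_natCast.1 (hn j ((dvd_add_right hj.2).1 hpe))
    exact Nat.eq_zero_of_dvd_of_lt this hjn
  subst hj0
  exact ⟨a 0, ha 0, by simp [hw]⟩

theorem Int.dvd_of_dvd_mul_of_eq_mul_gcd {e n : ℕ} {δ : ℤ} (he : 0 < e)
    (hn : e = n * Int.gcd e δ) (i : ℤ) (h : (e : ℤ) ∣ i * δ) : (n : ℤ) ∣ i := by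
  have hpos : (Int.gcd e δ : ℤ) ≠ 0 := by
    exact_mod_cast (Int.gcd_pos_of_ne_zero_left δ (by exact_mod_cast he.ne')).ne'
  refine Int.dvd_of_mul_dvd_mul_right hpos ?_
  rw [show (n : ℤ) * Int.gcd e δ = e by exact_mod_cast hn.symm, Int.gcd_eq_gcd_ab,
    show i * ((e : ℤ) * Int.gcdA e δ + δ * Int.gcdB e δ) =
      e * (i * Int.gcdA e δ) + i * δ * Int.gcdB e δ by ring]
  exact dvd_add (dvd_mul_right _ _) (h.mul_right _)

/-- Descent through the key polynomials: at every level `(N, e)` there is a key polynomial over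
`R`, and every polynomial over `R` with valuation divisible by `e` can be reduced to one of degree
less than `N` with the same valuation. -/
theorem IsLevel.exists_key_and_reduction [CharZero L] (hR : ∀ k : ℕ, ∃ u : R, ((k : R) + 1) * u = 1)
    (hw1 : ∀ k : ℕ, w ((k : F) + 1) = 1) {m : ℕ} (hm : 0 < m)
    (hwm : ∀ c : L, c ≠ 0 → (m : ℤ) ∣ (w (algebraMap L F c)).log)
    (hcount : ∀ N e : ℕ, N * e = m → ∃ a : L[X], a ≠ 0 ∧ a.degree < (N + 1 : ℕ) ∧
      (aeval g a = 0 ∨ ¬ (e : ℤ) ∣ (w (aeval g a)).log))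
    {P p : R[X]} (hP : P.Monic) (hPmin : P.map (algebraMap R L) = minpoly L g)
    (hp0 : aeval g (p.map (algebraMap R L)) ≠ 0) {e : ℕ} {N : ℕ} (hNe : N * e = m)
    (hG : IsLevel w g N e L) (hpe : (e : ℤ) ∣ (w (aeval g (p.map (algebraMap R L)))).log) :
    (∃ ψ : R[X], ψ.Monic ∧ ψ.natDegree = N ∧ (aeval g (ψ.map (algebraMap R L)) = 0 ∨
      ¬ (e : ℤ) ∣ (w (aeval g (ψ.map (algebraMap R L)))).log)) ∧
    ∃ q : R[X], q.degree < N ∧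
      w (aeval g (q.map (algebraMap R L))) = w (aeval g (p.map (algebraMap R L))) := by
  have hinj := FaithfulSMul.algebraMap_injective R L
  have : Nontrivial R := (algebraMap R L).domain_nontrivial
  induction e using Nat.strong_induction_on generalizing N with
  | _ e ih =>
  have hN : 0 < N := Nat.pos_of_ne_zero fun h => by simp [h] at hNe; omega
  have he : 0 < e := Nat.pos_of_ne_zero fun h => by simp [h] at hNe; omega
  obtain ⟨a, ha0, had, ha⟩ := hcount N e hNe
  have hadN : a.natDegree = N := by
    have h1 := (natDegree_lt_iff_degree_lt ha0).2 had
    by_contra hne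
    obtain ⟨h2, h3⟩ := hG a ha0 ((natDegree_lt_iff_degree_lt ha0).1 (by omega))
    exact ha.elim h2 fun h => h h3
  by_cases hag : aeval g a = 0
  · have hPg : aeval g (P.map (algebraMap R L)) = 0 := by rw [hPmin, minpoly.aeval]
    have hPN : P.natDegree = N := by
      apply le_antisymm
      · rw [← hadN, ← hP.natDegree_map (algebraMap R L), hPmin]
        exact natDegree_le_of_dvd (minpoly.dvd L g hag) ha0
      · by_contra! hlt
        refine (hG _ (hP.map (algebraMap R L)).ne_zero ?_).1 hPg
        rw [hP.degree_map]
        exact (natDegree_lt_iff_degree_lt hP.ne_zero).1 hlt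
    refine ⟨⟨P, hP, hPN, Or.inl hPg⟩, p %ₘ P, ?_, ?_⟩
    · rw [← hPN, ← degree_eq_natDegree hP.ne_zero]
      exact degree_modByMonic_lt _ hP
    · conv_rhs => rw [← modByMonic_add_div p P]
      simp only [Polynomial.map_add, Polynomial.map_mul, map_add, map_mul, hPg, zero_mul, add_zero]
  have hae := ha.resolve_left hag
  have hlc : a.leadingCoeff ≠ 0 := leadingCoeff_ne_zero.2 ha0
  set φ : L[X] := a * C a.leadingCoeff⁻¹ with hφdef
  have hφ : φ.Monic := monic_mul_leadingCoeff_inv ha0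
  have hφN : φ.natDegree = N := by
    rw [hφdef, natDegree_mul_leadingCoeff_inv a ha0, hadN]
  have hφg : aeval g φ = aeval g a * algebraMap L F a.leadingCoeff⁻¹ := by
    rw [hφdef, map_mul, aeval_C]
  have hinv : algebraMap L F a.leadingCoeff⁻¹ ≠ 0 := by simpa using hlc
  have hφ0 : aeval g φ ≠ 0 := by rw [hφg]; exact mul_ne_zero hag hinv
  have hem : (e : ℤ) ∣ m := by exact_mod_cast Dvd.intro_left N hNe
  have hφe : ¬ (e : ℤ) ∣ (w (aeval g φ)).log := by
    rw [hφg, map_mul, WithZero.log_mul (w.ne_zero_iff.2 hag) (w.ne_zero_iff.2 hinv)]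
    intro h
    exact hae ((dvd_add_left (hem.trans (hwm _ (inv_ne_zero hlc)))).1 h)
  set δ := (w (aeval g φ)).log with hδdef
  have hed : Int.gcd e δ ∣ e := Int.natCast_dvd_natCast.1 (Int.gcd_dvd_left _ _)
  have hed' : ((Int.gcd e δ : ℕ) : ℤ) ∣ e := Int.gcd_dvd_left _ _
  have hdδ : ((Int.gcd e δ : ℕ) : ℤ) ∣ δ := Int.gcd_dvd_right _ _
  obtain ⟨n, hn⟩ : ∃ n, e = n * Int.gcd e δ := ⟨_, (Nat.div_mul_cancel hed).symm⟩
  have hlt : Int.gcd e δ < e := lt_of_le_of_ne (Nat.le_of_dvd he hed) fun h => hφe (h ▸ hdδ)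
  obtain ⟨k, rfl⟩ : ∃ k, n = k + 1 := Nat.exists_eq_succ_of_ne_zero (by rintro rfl; omega)
  have hnd := Int.dvd_of_dvd_mul_of_eq_mul_gcd he hn
  obtain ⟨⟨Φ, hΦm, hΦN, hΦ⟩, q, hq, hqw⟩ := ih _ hlt (N := (k + 1) * N)
    (by rw [← hNe, mul_right_comm, ← hn, mul_comm])
    (hG.mul hφ hφN hφ0 hnd hed' hdδ) (hed'.trans hpe)
  obtain ⟨ψ, hψ, hψN, hψw⟩ := hG.exists_key_over_subring hN (hR k) (hw1 k) hφ hφN hφ0 hφe hnd hed'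
    hdδ hΦm hΦN hΦ
  refine ⟨⟨ψ, hψ, hψN, Or.inr (by rwa [hψw])⟩, ?_⟩
  rw [← hqw]
  refine hG.exists_reduction hψ hψN ?_ (by rwa [hψw]) hq ?_ (by rwa [hqw])
  · rwa [← w.ne_zero_iff, hψw, w.ne_zero_iff]
  · rwa [← w.ne_zero_iff, hqw, w.ne_zero_iff]

theorem exists_map_eq_minpoly_of_isIntegrallyClosed {R L F : Type*} [CommRing R] [IsDomain R]
    [IsIntegrallyClosed R] [Field L] [Algebra R L] [IsFractionRing R L] [Field F] [Algebra L F]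
    {g : F} {Q : R[X]} (hQ : Q.Monic) (hQg : aeval g (Q.map (algebraMap R L)) = 0) :
    ∃ P : R[X], P.Monic ∧ P.map (algebraMap R L) = minpoly L g := by
  let _ : Algebra R F := ((algebraMap L F).comp (algebraMap R L)).toAlgebra
  have : IsScalarTower R L F := IsScalarTower.of_algebraMap_eq fun _ => rfl
  have hg : IsIntegral R g := ⟨Q, hQ, by rwa [aeval_map_algebraMap] at hQg⟩
  exact ⟨minpoly R g, minpoly.monic hg, (minpoly.isIntegrallyClosed_eq_field_fractions' L hg).symm⟩

end Level

section Bivariate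

variable {K : Type*} [Field K] {f g : K[X]}

/-- If all the values of nonzero polynomials of `Y`-degree at most `N` at `(f, g)` were nonzero
with degree divisible by `e`, where `N * e = deg f`, there would be too many of them. -/
theorem Polynomial.exists_eval₂_eq_zero_or_not_dvd_natDegree (hf : 0 < f.natDegree) {N e : ℕ}
    (hNe : N * e = f.natDegree) :
    ∃ q : K[X][X], q ≠ 0 ∧ q.degree < (N + 1 : ℕ) ∧
      (eval₂ (compRingHom f) g q = 0 ∨ ¬ e ∣ (eval₂ (compRingHom f) g q).natDegree) := by
  by_contra! H
  have hN : 0 < N := Nat.pos_of_ne_zero fun h => by simp [h] at hNe; omega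
  have he : 0 < e := Nat.pos_of_ne_zero fun h => by simp [h] at hNe; omega
  obtain ⟨T, hT⟩ : ∃ T, T = N * g.natDegree := ⟨_, rfl⟩
  obtain ⟨ev, hev⟩ : ∃ ev : (Fin (N + 1) → Fin (T + 1) → K) →ₗ[K] K[X],
      ∀ c, ev c = ∑ j, (∑ i, C (c j i) * f ^ (i : ℕ)) * g ^ (j : ℕ) :=
    ⟨{ toFun := fun c => ∑ j, (∑ i, C (c j i) * f ^ (i : ℕ)) * g ^ (j : ℕ)
       map_add' := fun c c' => by simp [add_mul, Finset.sum_add_distrib]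
       map_smul' := fun r c => by
        simp [Finset.smul_sum, Finset.sum_mul, smul_eq_C_mul, mul_assoc] }, fun _ => rfl⟩
  obtain ⟨co, hco⟩ : ∃ co : K[X] →ₗ[K] (Fin (T + T * N + 1) → K),
      ∀ p i, co p i = p.coeff (e * (i : ℕ)) :=
    ⟨LinearMap.pi fun i => lcoeff K (e * (i : ℕ)), fun _ _ => rfl⟩
  have hinj : Function.Injective (co.comp ev) := by
    rw [← LinearMap.ker_eq_bot, LinearMap.ker_eq_bot']
    intro c hc
    by_contra hc0
    let q : K[X][X] := ∑ j : Fin (N + 1),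
      monomial (j : ℕ) (∑ i : Fin (T + 1), monomial (i : ℕ) (c j i))
    have hcoeff : ∀ j i, (q.coeff (j : Fin (N + 1))).coeff (i : Fin (T + 1)) = c j i := by
      intro j i
      simp [q, coeff_monomial, Fin.val_inj]
    have hq0 : q ≠ 0 := by
      rintro h
      apply hc0
      ext j i
      rw [← hcoeff, h]
      simp
    have hqd : q.degree < (N + 1 : ℕ) := by
      refine (degree_sum_le _ _).trans_lt ((Finset.sup_lt_iff (WithBot.bot_lt_coe _)).2 ?_)
      intro j _
      exact (degree_monomial_le _ _).trans_lt (by exact_mod_cast j.2)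
    have hqe : eval₂ (compRingHom f) g q = ev c := by
      simp [q, hev, eval₂_finsetSum, eval₂_monomial, Finset.sum_mul]
    obtain ⟨h1, k, hk⟩ := H q hq0 hqd
    rw [hqe] at h1 hk
    have hdeg : (ev c).natDegree ≤ T * f.natDegree + N * g.natDegree := by
      rw [hev]
      refine natDegree_sum_le_of_forall_le _ _ fun j _ => natDegree_mul_le.trans (add_le_add ?_ ?_)
      · refine natDegree_sum_le_of_forall_le _ _ fun i _ => (natDegree_C_mul_le _ _).trans ?_
        exact natDegree_pow_le.trans (Nat.mul_le_mul_right _ (Nat.lt_succ_iff.1 i.2))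
      · exact natDegree_pow_le.trans (Nat.mul_le_mul_right _ (Nat.lt_succ_iff.1 j.2))
    have hkB : k < T + T * N + 1 := by
      rw [Nat.lt_succ_iff]
      refine Nat.le_of_mul_le_mul_left ?_ he
      rw [← hk]
      refine hdeg.trans ?_
      rw [← hNe, ← hT]
      nlinarith [Nat.le_mul_of_pos_left T he]
    have := congrFun hc ⟨k, hkB⟩
    rw [LinearMap.comp_apply, hco, ← hk, Pi.zero_apply] at this
    exact h1 (leadingCoeff_eq_zero.1 this)
  have hle := LinearMap.finrank_le_finrank_of_injective hinj
  simp only [Module.finrank_pi_fintype, Module.finrank_self, Finset.sum_const, Finset.card_univ,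
    Fintype.card_fin, smul_eq_mul, mul_one] at hle
  have : (N + 1) * (T + 1) = T + T * N + 1 + N := by ring
  omega

theorem Polynomial.exists_monic_eval₂_compRingHom_eq_zero (hf : 0 < f.natDegree) (g : K[X]) :
    ∃ Q : K[X][X], Q.Monic ∧ eval₂ (compRingHom f) g Q = 0 := by
  have hf0 : f ≠ 0 := by rintro rfl; simp at hf
  have hX : (compRingHom f).IsIntegralElem X := by
    have hd : (C (X : K[X])).degree < (f.map C).degree := by
      rw [degree_map]
      exact degree_C_le.trans_lt (natDegree_pos_iff_degree_pos.1 hf)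
    refine ⟨C (C f.leadingCoeff⁻¹) * (f.map C - C X), ?_, ?_⟩
    · rw [Monic, leadingCoeff_mul, leadingCoeff_C, leadingCoeff_sub_of_degree_lt hd,
        leadingCoeff_map, ← C_mul, inv_mul_cancel₀ (leadingCoeff_ne_zero.2 hf0), C_1]
    · have : (compRingHom f).comp C = C := by ext; simp
      rw [eval₂_mul, eval₂_sub, eval₂_map, this, eval₂_C_X]
      simp
  have hC : ∀ a : K, (compRingHom f).IsIntegralElem (C a) := fun a => by
    have := (compRingHom f).isIntegralElem_map (x := C a)
    simpa using this
  change (compRingHom f).IsIntegralElem g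
  induction g using Polynomial.induction_on' with
  | add p q hp hq => exact hp.add _ hq
  | monomial n a =>
    rw [← C_mul_X_pow_eq_monomial]
    refine (hC a).mul _ ?_
    induction n with
    | zero => simpa using hC 1
    | succ n ih => rw [pow_succ]; exact ih.mul _ hX

theorem Polynomial.exists_eval₂_compRingHom_eq_of_mem_adjoin {p : K[X]}
    (hp : p ∈ Algebra.adjoin K ({f, g} : Set K[X])) :
    ∃ q : K[X][X], eval₂ (compRingHom f) g q = p := by
  induction hp using Algebra.adjoin_induction with
  | mem x hx =>
    rcases hx with rfl | rfl
    · exact ⟨C X, by simp⟩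
    · exact ⟨X, by simp⟩
  | algebraMap r => exact ⟨C (C r), by simp [Polynomial.algebraMap_eq]⟩
  | add x y _ _ hx hy =>
    obtain ⟨a, rfl⟩ := hx
    obtain ⟨b, rfl⟩ := hy
    exact ⟨a + b, eval₂_add _ _⟩
  | mul x y _ _ hx hy =>
    obtain ⟨a, rfl⟩ := hx
    obtain ⟨b, rfl⟩ := hy
    exact ⟨a * b, eval₂_mul _ _⟩

/-- The degree of a polynomial in `f` and `g`, if divisible by `gcd (deg f) (deg g)`, is a
nonnegative combination of `deg f` and `deg g`. -/
theorem Polynomial.exists_natDegree_eq_add_of_mem_adjoin [CharZero K] (hf : 0 < f.natDegree)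
    (hg : 0 < g.natDegree) {p : K[X]} (hp : p ∈ Algebra.adjoin K ({f, g} : Set K[X]))
    (hp0 : p ≠ 0) (hd : Nat.gcd f.natDegree g.natDegree ∣ p.natDegree) :
    ∃ i j : ℕ, p.natDegree = f.natDegree * i + j * g.natDegree := by
  classical
  obtain ⟨q, rfl⟩ := exists_eval₂_compRingHom_eq_of_mem_adjoin hp
  let w : Valuation (RatFunc K) ℤᵐ⁰ := RatFunc.inftyValuation K
  have hw : ∀ c : K[X], c ≠ 0 → (w (algebraMap K[X] (RatFunc K) c)).log = c.natDegree := by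
    intro c hc
    rw [show w (algebraMap K[X] (RatFunc K) c) = _ from RatFunc.inftyValuation.polynomial K hc,
      WithZero.log_exp]
  have hinj := RatFunc.algebraMap_injective K
  have hcomp : ∀ c : K[X], c ≠ 0 → c.comp f ≠ 0 := fun c hc h => by
    rcases comp_eq_zero_iff.1 h with h | ⟨-, h⟩
    · exact hc h
    · rw [h, natDegree_C] at hf
      exact hf.false
  let ρ : K[X] →+* RatFunc K := (algebraMap K[X] (RatFunc K)).comp (compRingHom f)
  have hρ : Function.Injective ρ := (injective_iff_map_eq_zero ρ).2 fun c hc => by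
    by_contra h
    exact hcomp c h ((map_eq_zero_iff _ hinj).1 hc)
  let L := FractionRing K[X]
  have : CharZero L := charZero_of_injective_algebraMap (IsFractionRing.injective K[X] L)
  let _ : Algebra L (RatFunc K) := (IsFractionRing.lift hρ : L →+* RatFunc K).toAlgebra
  have hmap : ∀ c : K[X], algebraMap L (RatFunc K) (algebraMap K[X] L c) =
      algebraMap K[X] (RatFunc K) (c.comp f) := fun c => IsFractionRing.lift_algebraMap hρ c
  set G := algebraMap K[X] (RatFunc K) g with hGdef
  have hev : ∀ q : K[X][X], aeval G (q.map (algebraMap K[X] L)) =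
      algebraMap K[X] (RatFunc K) (eval₂ (compRingHom f) g q) := by
    intro q
    rw [aeval_def, eval₂_map, hom_eval₂]
    congr 1
    exact RingHom.ext hmap
  have hwm : ∀ c : L, c ≠ 0 →
      (f.natDegree : ℤ) ∣ (w (algebraMap L (RatFunc K) c)).log := by
    intro c hc
    obtain ⟨a, b, hb, rfl⟩ := IsFractionRing.div_surjective (A := K[X]) c
    have hb0 : b ≠ 0 := nonZeroDivisors.ne_zero hb
    have ha0 : a ≠ 0 := by rintro rfl; simp at hc
    have hne : ∀ c : K[X], c ≠ 0 → w (algebraMap K[X] (RatFunc K) (c.comp f)) ≠ 0 := fun c hc =>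
      w.ne_zero_iff.2 ((map_ne_zero_iff _ hinj).2 (hcomp c hc))
    rw [map_div₀, hmap, hmap, map_div₀, WithZero.log_div (hne a ha0) (hne b hb0),
      hw _ (hcomp a ha0), hw _ (hcomp b hb0), natDegree_comp, natDegree_comp]
    push_cast
    exact dvd_sub (dvd_mul_left _ _) (dvd_mul_left _ _)
  have hlevel : IsLevel w G 1 f.natDegree L := by
    intro a ha had
    rw [eq_C_of_degree_le_zero (Nat.WithBot.lt_one_iff_le_zero.1 had)] at ha ⊢
    have ha' : a.coeff 0 ≠ 0 := fun h => ha (by rw [h, C_0])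
    rw [aeval_C]
    exact ⟨(_root_.map_ne_zero _).2 ha', hwm _ ha'⟩
  have hg0 : g ≠ 0 := by rintro rfl; simp at hg
  have hG0 : aeval G (X : L[X]) ≠ 0 := by rw [aeval_X]; exact (map_ne_zero_iff _ hinj).2 hg0
  have hδ : (w (aeval G (X : L[X]))).log = g.natDegree := by rw [aeval_X, hGdef, hw g hg0]
  obtain ⟨n, hn⟩ := Nat.gcd_dvd_left f.natDegree g.natDegree
  rw [mul_comm] at hn
  have hnd : ∀ i : ℤ, (f.natDegree : ℤ) ∣ i * (w (aeval G (X : L[X]))).log → (n : ℤ) ∣ i := by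
    rw [hδ]
    exact Int.dvd_of_dvd_mul_of_eq_mul_gcd hf (by rwa [Int.gcd_natCast_natCast])
  have hlevel' : IsLevel w G (n * 1) (Nat.gcd f.natDegree g.natDegree) L :=
    hlevel.mul monic_X natDegree_X hG0 hnd (Int.natCast_dvd_natCast.2 (Nat.gcd_dvd_left _ _))
      (by rw [hδ]; exact Int.natCast_dvd_natCast.2 (Nat.gcd_dvd_right _ _))
  obtain ⟨Q, hQ, hQg⟩ := exists_monic_eval₂_compRingHom_eq_zero hf g
  obtain ⟨P, hP, hPmin⟩ := exists_map_eq_minpoly_of_isIntegrallyClosed (L := L) (g := G) hQ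
    (by rw [hev, hQg, map_zero])
  have hconst : ∀ k : ℕ, w ((k : RatFunc K) + 1) = 1 := fun k => by
    have hk : (k : K) + 1 ≠ 0 := by exact_mod_cast k.succ_ne_zero
    have := RatFunc.inftyValuation.C K hk
    simp only [map_add, map_natCast, map_one] at this
    exact this
  have hq0 : aeval G (q.map (algebraMap K[X] L)) ≠ 0 := by
    rw [hev]; exact (map_ne_zero_iff _ hinj).2 hp0
  obtain ⟨-, r, hr, hrw⟩ := hlevel'.exists_key_and_reduction (p := q)
    (fun k => ⟨C ((k : K) + 1)⁻¹, by
      have hk : (k : K) + 1 ≠ 0 := by exact_mod_cast k.succ_ne_zero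
      simpa only [map_mul, map_add, map_natCast, map_one] using
        congrArg C (mul_inv_cancel₀ hk)⟩)
    hconst hf hwm
    (fun N e hNe => by
      obtain ⟨q, hq0, hqd, hq⟩ := exists_eval₂_eq_zero_or_not_dvd_natDegree (g := g) hf hNe
      have hmi := IsFractionRing.injective K[X] L
      refine ⟨q.map (algebraMap K[X] L), (Polynomial.map_ne_zero_iff hmi).2 hq0, ?_, ?_⟩
      · rwa [degree_map_eq_of_injective hmi]
      · rw [hev]
        by_cases h0 : eval₂ (compRingHom f) g q = 0
        · exact Or.inl (by rw [h0, map_zero])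
        · rw [hw _ h0, Int.natCast_dvd_natCast]
          exact Or.inr (hq.resolve_left h0))
    hP hPmin hq0 (by rw [mul_one]; exact hn.symm)
    (by rw [hev, hw _ hp0]; exact Int.natCast_dvd_natCast.2 hd)
  rw [mul_one] at hr
  have hrsum : r.map (algebraMap K[X] L) =
      ∑ j ∈ Finset.range n, C (algebraMap K[X] L (r.coeff j)) * X ^ j := by
    have hr' : r = ∑ j ∈ Finset.range n, C (r.coeff j) * X ^ j := by
      by_cases h0 : r = 0
      · simp [h0]
      · exact as_sum_range_C_mul_X_pow' r ((natDegree_lt_iff_degree_lt h0).2 hr)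
    conv_lhs => rw [hr']
    simp [Polynomial.map_sum]
  have hne : ∃ j < n, C (algebraMap K[X] L (r.coeff j)) ≠ 0 := by
    by_contra! h
    rw [hrsum, Finset.sum_eq_zero fun j hj => by rw [h j (Finset.mem_range.1 hj), zero_mul],
      map_zero, map_zero] at hrw
    exact hq0 (w.zero_iff.1 hrw.symm)
  obtain ⟨j, -, hj, hjw, -⟩ := hlevel.exists_dominant hG0 hnd
    (a := fun j => C (algebraMap K[X] L (r.coeff j)))
    (fun j => degree_C_le.trans_lt (by exact_mod_cast one_pos)) hne
  have hj0 : r.coeff j ≠ 0 := by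
    intro h
    simp [h] at hj
  refine ⟨(r.coeff j).natDegree, j, ?_⟩
  have hlog := congrArg WithZero.log hrw
  rw [hrsum, hjw, hev, hw _ hp0, aeval_C, hmap, w.log_map_mul_pow
    ((map_ne_zero_iff _ hinj).2 (hcomp _ hj0)) hG0, hδ, hw _ (hcomp _ hj0), natDegree_comp] at hlog
  rw [mul_comm f.natDegree]
  exact_mod_cast hlog.symm

end Bivariate

/-- Richman's theorem: if `f, g` are nonconstant and `K[f,g]` contains a polynomial of
degree `d₀ = gcd(deg f, deg g)`, then `d₀ = deg f` or `d₀ = deg g`. -/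
theorem stmt14 (K : Type*) [Field K] [CharZero K] (f g : K[X])
    (hf : 0 < f.natDegree) (hg : 0 < g.natDegree)
    (h : ∃ p ∈ Algebra.adjoin K ({f, g} : Set K[X]),
      p.natDegree = Nat.gcd f.natDegree g.natDegree ∧ p ≠ 0) :
    Nat.gcd f.natDegree g.natDegree = f.natDegree ∨
      Nat.gcd f.natDegree g.natDegree = g.natDegree := by
  obtain ⟨p, hp, hpd, hp0⟩ := h
  obtain ⟨i, j, hij⟩ := exists_natDegree_eq_add_of_mem_adjoin hf hg hp hp0 hpd.symm.dvd
  rw [hpd] at hij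
  have hpos := Nat.gcd_pos_of_pos_left g.natDegree hf
  rcases Nat.eq_zero_or_pos j with rfl | hj
  · left
    exact Nat.dvd_antisymm (Nat.gcd_dvd_left _ _) ⟨i, by omega⟩
  · right
    have h1 := Nat.le_of_dvd hg (Nat.gcd_dvd_right f.natDegree g.natDegree)
    have h2 := Nat.le_mul_of_pos_left g.natDegree hj
    omega
end
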